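/- arXiv:0804.2187 — 9 statements merged into one kernel-verified Lean document; each statement's English description precedes it below -/
import Mathlib

section
/- (Gibbons–Tsarev compatibility conditions.) For every r ∈ Ω and all indices i ≠ k, the second mixed partial derivative of u = u₁ satisfies ∂_{r_i}∂_{r_k} u(r) = 2 (∂_{r_i} u(r)) (∂_{r_k} u(r)) / (λ_i(r) − λ_k(r))². -/
open Finset

open Polynomial in
theorem gt_ev_hasFDerivAt {n : ℕ} (A : ℝ[X]) (B : Fin n → ℝ[X])
    (u : Fin n → (Fin n → ℝ) → ℝ) (l : (Fin n → ℝ) → ℝ) (r v : Fin n → ℝ)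
    (hu : ∀ k, DifferentiableAt ℝ (u k) r) (hl : DifferentiableAt ℝ l r) :
    DifferentiableAt ℝ (fun x => A.eval (l x) + ∑ k, u k x * (B k).eval (l x)) r ∧
    fderiv ℝ (fun x => A.eval (l x) + ∑ k, u k x * (B k).eval (l x)) r v =
      ∑ k, fderiv ℝ (u k) r v * (B k).eval (l r) +
      ((derivative A).eval (l r) + ∑ k, u k r * (derivative (B k)).eval (l r)) * fderiv ℝ l r v := by
  have hp : ∀ q : ℝ[X], HasFDerivAt (fun x => q.eval (l x))
      ((derivative q).eval (l r) • fderiv ℝ l r) r := fun q =>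
    (q.hasDerivAt (l r)).comp_hasFDerivAt r hl.hasFDerivAt
  have h := (hp A).add (HasFDerivAt.fun_sum (u := Finset.univ)
    (fun k _ => (hu k).hasFDerivAt.mul (hp (B k))))
  have h' : HasFDerivAt (fun x => A.eval (l x) + ∑ k, u k x * (B k).eval (l x)) _ r := h
  refine ⟨h'.differentiableAt, ?_⟩
  rw [h'.fderiv]
  simp only [add_apply, smul_apply, smul_eq_mul, _root_.sum_apply,
    add_mul, Finset.sum_mul, Finset.sum_add_distrib]
  have e1 : ∀ k, u k r * (eval (l r) (derivative (B k)) * (fderiv ℝ l r) v) =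
    u k r * eval (l r) (derivative (B k)) * (fderiv ℝ l r) v := fun k => by ring
  have e2 : ∀ k, eval (l r) (B k) * (fderiv ℝ (u k) r) v =
    (fderiv ℝ (u k) r) v * eval (l r) (B k) := fun k => by ring
  simp only [e1, e2]
  ring

open Polynomial in
theorem gt_poly {m : ℕ} (a c lam : Fin (m + 1) → ℝ) (i : Fin (m + 1))
    (hinj : Function.Injective lam)
    (hcrit : ∀ j, (X ^ (m + 1) + ∑ k : Fin (m+1), C (a k) * derivative (X ^ (m - (k : ℕ)))).eval (lam j) = 0)
    (hQ : ∀ j, j ≠ i → (∑ k : Fin (m+1), C (c k) * X ^ (m - (k : ℕ))).eval (lam j) = 0) :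
    (∑ k : Fin (m+1), C (c k) * X ^ (m - (k : ℕ))) * (X - C (lam i)) =
      C (c 0) * (X ^ (m + 1) + ∑ k : Fin (m+1), C (a k) * derivative (X ^ (m - (k : ℕ)))) := by
  apply Polynomial.eq_of_degree_sub_lt_of_eval_index_eq (s := Finset.univ) (v := lam) (ι := Fin (m+1))
  · exact hinj.injOn
  · have hS : (∑ k : Fin (m+1), C (a k) * derivative (X ^ (m - (k : ℕ)))).degree < ((m + 1 : ℕ) : WithBot ℕ) := by
      rw [← Polynomial.mem_degreeLT]
      refine Submodule.sum_mem _ fun k _ => ?_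
      rw [← smul_eq_C_mul]
      refine Submodule.smul_mem _ _ ?_
      rw [Polynomial.mem_degreeLT]
      refine (degree_derivative_le).trans_lt ?_
      rw [degree_X_pow]
      exact_mod_cast (by omega)
    have hR : (∑ k : Fin m, C (c k.succ) * X ^ (m - ((k.succ : Fin (m+1)) : ℕ))).degree < (m : WithBot ℕ) := by
      rw [← Polynomial.mem_degreeLT]
      refine Submodule.sum_mem _ fun k _ => ?_
      rw [← smul_eq_C_mul]
      refine Submodule.smul_mem _ _ ?_
      rw [Polynomial.mem_degreeLT, degree_X_pow]
      have := k.2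
      exact_mod_cast (by simp only [Fin.val_succ]; omega)
    generalize (∑ k : Fin (m+1), C (a k) * derivative (X ^ (m - (k : ℕ)))) = S at hS
    rw [Fin.sum_univ_succ]
    generalize (∑ k : Fin m, C (c k.succ) * X ^ (m - ((k.succ : Fin (m+1)) : ℕ))) = R at hR
    have e : (C (c 0) * X ^ (m - ((0 : Fin (m+1)) : ℕ)) + R) * (X - C (lam i)) - C (c 0) * (X ^ (m + 1) + S)
       = R * (X - C (lam i)) - (c 0 * lam i) • X ^ m - c 0 • S := by
      simp only [Fin.val_zero, Nat.sub_zero, smul_eq_C_mul, C_mul]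
      ring
    rw [e, Finset.card_univ, Fintype.card_fin, ← Polynomial.mem_degreeLT]
    refine Submodule.sub_mem _ (Submodule.sub_mem _ ?_ (Submodule.smul_mem _ _ ?_)) (Submodule.smul_mem _ _ ?_)
    · rw [Polynomial.mem_degreeLT, degree_mul, degree_X_sub_C]
      push_cast
      exact WithBot.add_lt_add_right (by simp) hR
    · rw [Polynomial.mem_degreeLT, degree_X_pow]
      exact_mod_cast (by omega)
    · rwa [Polynomial.mem_degreeLT]
  · intro j _
    rw [eval_mul, eval_mul, hcrit j, mul_zero]
    by_cases h : j = i
    · subst h; simp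
    · rw [hQ j h, zero_mul]

/-- Gibbons–Tsarev compatibility conditions: for `i ≠ k`,
`∂_{rᵢ}∂_{r_k} u = 2 (∂_{rᵢ} u)(∂_{r_k} u) / (λᵢ - λ_k)²`, where `u = u₁`. -/
theorem gibbons_tsarev_compatibility
    (n : ℕ) (hn : 2 ≤ n)
    (Ω : Set (Fin n → ℝ)) (hΩ : IsOpen Ω)
    (u lam : Fin n → (Fin n → ℝ) → ℝ)
    (hu : ∀ k, ContDiffOn ℝ (⊤ : ℕ∞) (u k) Ω)
    (hlam : ∀ i, ContDiffOn ℝ (⊤ : ℕ∞) (lam i) Ω)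
    (F : (Fin n → ℝ) → ℝ → ℝ)
    (hF : ∀ r p, F r p =
      p ^ (n + 1) / ((n : ℝ) + 1) + ∑ k : Fin n, u k r * p ^ (n - 1 - (k : ℕ)))
    (hdist : ∀ r ∈ Ω, ∀ i j : Fin n, i ≠ j → lam i r ≠ lam j r)
    (hcrit : ∀ r ∈ Ω, ∀ i, deriv (F r) (lam i r) = 0)
    (hval : ∀ r ∈ Ω, ∀ i, F r (lam i r) = r i) :
    ∀ r ∈ Ω, ∀ i k : Fin n, i ≠ k →
      fderiv ℝ (fun x => fderiv ℝ (u ⟨0, by omega⟩) x (Pi.single k 1)) r (Pi.single i 1) =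
        2 * fderiv ℝ (u ⟨0, by omega⟩) r (Pi.single i 1) *
          fderiv ℝ (u ⟨0, by omega⟩) r (Pi.single k 1) / (lam i r - lam k r) ^ 2 := by
  obtain ⟨m, rfl⟩ : ∃ m, n = m + 1 := ⟨n - 1, by omega⟩
  have hz : (⟨0, by omega⟩ : Fin (m + 1)) = 0 := rfl
  simp only [hz]
  set A : Polynomial ℝ := Polynomial.C (1 / ((m : ℝ) + 2)) * Polynomial.X ^ (m + 2) with hA
  set B : Fin (m + 1) → Polynomial ℝ := fun k => Polynomial.X ^ (m - (k : ℕ)) with hB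
  have hA' : Polynomial.derivative A = Polynomial.X ^ (m + 1) := by
    have h2 : (m : ℝ) + 2 ≠ 0 := by positivity
    rw [hA, Polynomial.derivative_C_mul, Polynomial.derivative_X_pow, ← mul_assoc, ← Polynomial.C_mul]
    have : 1 / ((m : ℝ) + 2) * ((m + 2 : ℕ) : ℝ) = 1 := by push_cast; field_simp
    rw [this]; simp
  have hFA : ∀ r p, F r p = A.eval p + ∑ k, u k r * (B k).eval p := by
    intro r p
    rw [hF]
    simp only [hA, hB, Polynomial.eval_mul, Polynomial.eval_C, Polynomial.eval_pow, Polynomial.eval_X]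
    push_cast
    congr 1
    ring
  have hFd : ∀ r p, deriv (F r) p = (Polynomial.derivative A).eval p
      + ∑ k, u k r * (Polynomial.derivative (B k)).eval p := by
    intro r p
    have : F r = fun p => (A + ∑ k, Polynomial.C (u k r) * B k).eval p := by
      funext p; rw [hFA]; simp [Polynomial.eval_finsetSum]
    rw [this, Polynomial.deriv]
    simp [Polynomial.eval_finsetSum]
  have hud : ∀ r ∈ Ω, ∀ k, DifferentiableAt ℝ (u k) r := fun r hr k =>
    ((hu k).contDiffAt (hΩ.mem_nhds hr)).differentiableAt (by simp)
  have hld : ∀ r ∈ Ω, ∀ k, DifferentiableAt ℝ (lam k) r := fun r hr k =>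
    ((hlam k).contDiffAt (hΩ.mem_nhds hr)).differentiableAt (by simp)
  have hcr : ∀ r ∈ Ω, ∀ j, (Polynomial.derivative A).eval (lam j r)
      + ∑ k, u k r * (Polynomial.derivative (B k)).eval (lam j r) = 0 := fun r hr j => by
    rw [← hFd]; exact hcrit r hr j
  -- Lagrange property
  have hQ : ∀ r ∈ Ω, ∀ i j, ∑ k, fderiv ℝ (u k) r (Pi.single i 1) * (B k).eval (lam j r) =
      (Pi.single i (1 : ℝ) : Fin (m + 1) → ℝ) j := by
    intro r hr i j
    have h1 := (gt_ev_hasFDerivAt A B u (lam j) r (Pi.single i 1) (hud r hr) (hld r hr j)).2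
    rw [hcr r hr j, zero_mul, add_zero] at h1
    rw [← h1]
    have h2 : (fun x => A.eval (lam j x) + ∑ k, u k x * (B k).eval (lam j x)) =ᶠ[nhds r]
        fun x => x j := by
      filter_upwards [hΩ.mem_nhds hr] with x hx
      rw [← hFA, hval x hx]
    rw [h2.fderiv_eq]
    have h3 : HasFDerivAt (fun x : Fin (m + 1) → ℝ => x j)
        (ContinuousLinearMap.proj (R := ℝ) (φ := fun _ : Fin (m + 1) => ℝ) j) r :=
      hasFDerivAt_apply j r
    rw [h3.fderiv]; rfl
  have hpoly : ∀ r ∈ Ω, ∀ i, (∑ k, Polynomial.C (fderiv ℝ (u k) r (Pi.single i 1)) * B k) *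
      (Polynomial.X - Polynomial.C (lam i r)) =
      Polynomial.C (fderiv ℝ (u 0) r (Pi.single i 1)) *
        (Polynomial.derivative A + ∑ k, Polynomial.C (u k r) * Polynomial.derivative (B k)) := by
    intro r hr i
    rw [hA']
    refine gt_poly (fun k => u k r) (fun k => fderiv ℝ (u k) r (Pi.single i 1))
      (fun k => lam k r) i ?_ ?_ ?_
    · intro a b hab
      by_contra hne
      exact hdist r hr a b hne hab
    · intro j
      have := hcr r hr j
      rw [hA'] at this
      simpa [Polynomial.eval_finsetSum, hB] using this
    · intro j hj
      have := hQ r hr i j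
      rw [Pi.single_eq_of_ne hj] at this
      simpa [Polynomial.eval_finsetSum, hB] using this
  set A1 := Polynomial.derivative A
  set A2 := Polynomial.derivative A1
  set A3 := Polynomial.derivative A2
  have hd1 : ∀ r ∈ Ω, ∀ i p,
      (∑ k, fderiv ℝ (u k) r (Pi.single i 1) * (Polynomial.derivative (B k)).eval p) * (p - lam i r)
      + ∑ k, fderiv ℝ (u k) r (Pi.single i 1) * (B k).eval p =
      fderiv ℝ (u 0) r (Pi.single i 1) * (A2.eval p +
        ∑ k, u k r * (Polynomial.derivative (Polynomial.derivative (B k))).eval p) := by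
    intro r hr i p
    have := congrArg (fun q => (Polynomial.derivative q).eval p) (hpoly r hr i)
    simpa [Polynomial.eval_finsetSum, hB, A2] using this
  have hd2 : ∀ r ∈ Ω, ∀ i p,
      (∑ k, fderiv ℝ (u k) r (Pi.single i 1) *
        (Polynomial.derivative (Polynomial.derivative (B k))).eval p) * (p - lam i r)
      + 2 * ∑ k, fderiv ℝ (u k) r (Pi.single i 1) * (Polynomial.derivative (B k)).eval p =
      fderiv ℝ (u 0) r (Pi.single i 1) * (A3.eval p +
        ∑ k, u k r * (Polynomial.derivative
          (Polynomial.derivative (Polynomial.derivative (B k)))).eval p) := by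
    intro r hr i p
    have := congrArg (fun q => (Polynomial.derivative (Polynomial.derivative q)).eval p)
      (hpoly r hr i)
    clear_value B A1
    simp [Polynomial.eval_finsetSum] at this
    simp only [A3, A2]
    linear_combination this
  intro r hr i k hik
  have hnorm : ∀ x ∈ Ω, fderiv ℝ (u 0) x (Pi.single k 1) * (A2.eval (lam k x) +
        ∑ j, u j x * (Polynomial.derivative (Polynomial.derivative (B j))).eval (lam k x)) = 1 := by
    intro x hx
    rw [← hd1 x hx k, hQ x hx k k]
    simp
  obtain ⟨hE1, hE2⟩ := gt_ev_hasFDerivAt A2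
    (fun j => Polynomial.derivative (Polynomial.derivative (B j))) u (lam k) r (Pi.single i 1)
    (hud r hr) (hld r hr k)
  have hcd : DifferentiableAt ℝ (fun x => fderiv ℝ (u 0) x (Pi.single k 1)) r := by
    have h1 : ContDiffAt ℝ 1 (fderiv ℝ (u 0)) r :=
      ((hu 0).contDiffAt (hΩ.mem_nhds hr)).fderiv_right (m := 1) (by
        have h : ((2 : ℕ∞) : WithTop ℕ∞) ≤ ((⊤ : ℕ∞) : WithTop ℕ∞) := WithTop.coe_le_coe.mpr le_top
        have h2 : (1 + 1 : WithTop ℕ∞) = ((2 : ℕ∞) : WithTop ℕ∞) := by norm_num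
        rw [h2]; exact h)
    exact (h1.differentiableAt (by simp)).clm_apply (differentiableAt_const _)
  have hD : fderiv ℝ (fun x => fderiv ℝ (u 0) x (Pi.single k 1) * (A2.eval (lam k x) +
        ∑ j, u j x * (Polynomial.derivative (Polynomial.derivative (B j))).eval (lam k x))) r
        (Pi.single i 1) = 0 := by
    have h2 : (fun x => fderiv ℝ (u 0) x (Pi.single k 1) * (A2.eval (lam k x) +
        ∑ j, u j x * (Polynomial.derivative (Polynomial.derivative (B j))).eval (lam k x)))
        =ᶠ[nhds r] fun _ => (1 : ℝ) := by
      filter_upwards [hΩ.mem_nhds hr] with x hx using hnorm x hx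
    rw [h2.fderiv_eq]; simp
  rw [fderiv_fun_mul hcd hE1] at hD
  simp only [add_apply, smul_apply, smul_eq_mul] at hD
  rw [hE2] at hD
  have hL := (gt_ev_hasFDerivAt A1 (fun j => Polynomial.derivative (B j)) u (lam k) r
    (Pi.single i 1) (hud r hr) (hld r hr k)).2
  have hL0 : fderiv ℝ (fun x => A1.eval (lam k x) +
        ∑ j, u j x * (Polynomial.derivative (B j)).eval (lam k x)) r (Pi.single i 1) = 0 := by
    have h2 : (fun x => A1.eval (lam k x) +
        ∑ j, u j x * (Polynomial.derivative (B j)).eval (lam k x))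
        =ᶠ[nhds r] fun _ => (0 : ℝ) := by
      filter_upwards [hΩ.mem_nhds hr] with x hx using hcr x hx k
    rw [h2.fderiv_eq]; simp
  rw [hL0] at hL
  have g1 := hd1 r hr i (lam k r)
  have g2 := hd2 r hr i (lam k r)
  have g0 := hnorm r hr
  rw [hQ r hr i k, Pi.single_eq_of_ne (Ne.symm hik)] at g1
  have hd : lam i r - lam k r ≠ 0 := sub_ne_zero.mpr (hdist r hr i k hik)
  change _ = _ + (A2.eval (lam k r) + _) * _ at hL
  change _ * (_ + (A3.eval (lam k r) + _) * _) + _ = _ at hD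
  generalize A2.eval (lam k r) + ∑ j, u j r *
    (Polynomial.derivative (Polynomial.derivative (B j))).eval (lam k r) = a at *
  generalize A3.eval (lam k r) + ∑ j, u j r * (Polynomial.derivative
    (Polynomial.derivative (Polynomial.derivative (B j)))).eval (lam k r) = t at *
  generalize ∑ j, fderiv ℝ (u j) r (Pi.single i 1) *
    (Polynomial.derivative (Polynomial.derivative (B j))).eval (lam k r) = q2 at *
  generalize ∑ j, fderiv ℝ (u j) r (Pi.single i 1) *
    (Polynomial.derivative (B j)).eval (lam k r) = q1 at *
  generalize fderiv ℝ (fun x => fderiv ℝ (u 0) x (Pi.single k 1)) r (Pi.single i 1) = D at *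
  generalize fderiv ℝ (u 0) r (Pi.single i 1) = ci at *
  generalize fderiv ℝ (u 0) r (Pi.single k 1) = ck at *
  generalize fderiv ℝ (lam k) r (Pi.single i 1) = L at *
  generalize lam i r = x at *
  generalize lam k r = y at *
  have ha : a ≠ 0 := right_ne_zero_of_mul_eq_one g0
  have hLd : L * (x - y) = ci := by
    apply mul_left_cancel₀ ha
    linear_combination -(x - y) * hL + g1
  rw [eq_div_iff (pow_ne_zero 2 hd)]
  apply mul_left_cancel₀ ha
  linear_combination (x - y) ^ 2 * hD - ck * t * (x - y) * hLd + ck * (x - y) * g2 + 2 * ck * g1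
end

section
/- (Genuine nonlinearity of the extreme eigenvalues.) Assume in addition that λ₁(r) < λ₂(r) < … < λ_n(r) for every r ∈ Ω (strict hyperbolicity). Then the maximal and minimal eigenvalues are genuinely nonlinear in the sense of Lax: ∂_{r₁} λ₁(r) ≠ 0 and ∂_{r_n} λ_n(r) ≠ 0 for every r ∈ Ω. -/
open Finset

theorem aux_basis_deriv {n : ℕ} (v : Fin n → ℝ) (hv : Function.Injective v) (i : Fin n) :
    (Polynomial.derivative (Lagrange.basis univ v i)).eval (v i)
      = ∑ j ∈ univ.erase i, (v i - v j)⁻¹ := by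
  rw [Lagrange.basis, Polynomial.derivative_prod_finset, Polynomial.eval_finsetSum]
  refine Finset.sum_congr rfl fun j hj => ?_
  rw [Polynomial.eval_mul, Polynomial.eval_prod, Finset.prod_eq_one]
  · simp [Lagrange.basisDivisor]
  · intro k hk
    have hk' : k ≠ i := (Finset.mem_erase.mp (Finset.mem_of_mem_erase hk)).1
    exact Lagrange.eval_basisDivisor_left_of_ne (fun h => hk' (hv h).symm)

theorem aux_line {n : ℕ} {Ω : Set (Fin n → ℝ)} (hΩ : IsOpen Ω) {f : (Fin n → ℝ) → ℝ}
    (hf : ContDiffOn ℝ (⊤ : ℕ∞) f Ω) {r : Fin n → ℝ} (hr : r ∈ Ω) (e : Fin n → ℝ) :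
    HasDerivAt (fun t : ℝ => f (r + t • e)) (fderiv ℝ f r e) 0 := by
  have h1 : DifferentiableAt ℝ f r :=
    (hf.contDiffAt (hΩ.mem_nhds hr)).differentiableAt (by simp)
  have h2 : HasDerivAt (fun t : ℝ => r + t • e) e 0 := by
    simpa using ((hasDerivAt_id (0 : ℝ)).smul_const e).const_add r
  have h1' : HasFDerivAt f (fderiv ℝ f r) (r + (0 : ℝ) • e) := by
    simpa using h1.hasFDerivAt
  exact h1'.comp_hasDerivAt 0 h2

theorem aux_main
    (n : ℕ)
    (Ω : Set (Fin n → ℝ)) (hΩ : IsOpen Ω)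
    (u lam : Fin n → (Fin n → ℝ) → ℝ)
    (hu : ∀ k, ContDiffOn ℝ (⊤ : ℕ∞) (u k) Ω)
    (hlam : ∀ i, ContDiffOn ℝ (⊤ : ℕ∞) (lam i) Ω)
    (F : (Fin n → ℝ) → ℝ → ℝ)
    (hF : ∀ r p, F r p =
      p ^ (n + 1) / ((n : ℝ) + 1) + ∑ k : Fin n, u k r * p ^ (n - 1 - (k : ℕ)))
    (hcrit : ∀ r ∈ Ω, ∀ i, deriv (F r) (lam i r) = 0)
    (hval : ∀ r ∈ Ω, ∀ i, F r (lam i r) = r i)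
    (r : Fin n → ℝ) (hr : r ∈ Ω) (hinj : Function.Injective (fun j => lam j r)) (i : Fin n)
    (h0 : fderiv ℝ (lam i) r (Pi.single i 1) = 0) :
    ∑ j ∈ univ.erase i, (lam i r - lam j r)⁻¹ = 0 := by
  set e : Fin n → ℝ := Pi.single i 1 with he
  have hn1 : ((n : ℝ) + 1) ≠ 0 := by positivity
  have hd : ∀ s p, deriv (F s) p = p ^ n + ∑ k : Fin n,
      u k s * (((n - 1 - (k : ℕ) : ℕ) : ℝ) * p ^ (n - 1 - (k : ℕ) - 1)) := by
    intro s p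
    have hFs : F s = fun p => p ^ (n + 1) / ((n : ℝ) + 1)
        + ∑ k : Fin n, u k s * p ^ (n - 1 - (k : ℕ)) := funext (hF s)
    rw [hFs]
    have h1 := (hasDerivAt_pow (n + 1) p).div_const ((n : ℝ) + 1)
    have h2 := HasDerivAt.fun_sum (u := univ) (fun (k : Fin n) _ =>
      (hasDerivAt_pow (n - 1 - (k : ℕ)) p).const_mul (u k s))
    rw [(h1.fun_add h2).deriv]
    congr 1
    push_cast
    try simp only [Nat.add_sub_cancel]
    field_simp
  have hU := fun k => aux_line hΩ (hu k) hr e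
  have hL := fun j => aux_line hΩ (hlam j) hr e
  have hmem : ∀ᶠ t : ℝ in nhds 0, r + t • e ∈ Ω := by
    have hc : Continuous (fun t : ℝ => r + t • e) := by fun_prop
    exact hc.continuousAt.eventually_mem (hΩ.mem_nhds (by simpa using hr))
  set P : Polynomial ℝ := ∑ k : Fin n,
    Polynomial.C (fderiv ℝ (u k) r e) * Polynomial.X ^ (n - 1 - (k : ℕ)) with hP
  have hPe : ∀ j, P.eval (lam j r) = e j := by
    intro j
    have h1 := ((hL j).fun_pow (n + 1)).div_const ((n : ℝ) + 1)
    have h2 := HasDerivAt.fun_sum (u := univ) (fun (k : Fin n) _ =>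
      (hU k).fun_mul ((hL j).fun_pow (n - 1 - (k : ℕ))))
    have h3 := h1.fun_add h2
    have h4 : HasDerivAt (fun t : ℝ => r j + t * e j) (e j) 0 := by
      simpa using ((hasDerivAt_id (0 : ℝ)).mul_const (e j)).const_add (r j)
    have h5 := h4.congr_of_eventuallyEq (f₁ := fun t : ℝ =>
      lam j (r + t • e) ^ (n + 1) / ((n : ℝ) + 1)
        + ∑ k : Fin n, u k (r + t • e) * lam j (r + t • e) ^ (n - 1 - (k : ℕ))) (by
      filter_upwards [hmem] with t ht
      have := hval _ ht j
      rw [hF] at this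
      simpa using this)
    have h6 := h3.unique h5
    have h7 := hcrit r hr j
    rw [hd] at h7
    simp only [zero_smul, add_zero, Nat.add_sub_cancel] at h6
    rw [← h6, hP, Polynomial.eval_finsetSum, Finset.sum_add_distrib]
    simp only [Polynomial.eval_mul, Polynomial.eval_C, Polynomial.eval_pow, Polynomial.eval_X]
    have h8 : ((n + 1 : ℕ) : ℝ) * lam j r ^ n * fderiv ℝ (lam j) r e / ((n : ℝ) + 1)
        = lam j r ^ n * fderiv ℝ (lam j) r e := by
      push_cast; field_simp
    have h9 : ∑ k : Fin n, u k r * (((n - 1 - (k : ℕ) : ℕ) : ℝ) *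
        lam j r ^ (n - 1 - (k : ℕ) - 1) * fderiv ℝ (lam j) r e)
        = (∑ k : Fin n, u k r * (((n - 1 - (k : ℕ) : ℕ) : ℝ) *
        lam j r ^ (n - 1 - (k : ℕ) - 1))) * fderiv ℝ (lam j) r e := by
      rw [Finset.sum_mul]
      exact Finset.sum_congr rfl fun k _ => by ring
    rw [h8, h9]
    linear_combination (-fderiv ℝ (lam j) r e) * h7
  have hPd : (Polynomial.derivative P).eval (lam i r) = 0 := by
    have hLi := hL i
    rw [h0] at hLi
    have h1 := hLi.fun_pow n
    have h2 := HasDerivAt.fun_sum (u := univ) (fun (k : Fin n) _ =>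
      (hU k).fun_mul ((hLi.fun_pow (n - 1 - (k : ℕ) - 1)).const_mul
        (((n - 1 - (k : ℕ) : ℕ) : ℝ))))
    have h3 := h1.fun_add h2
    have h5 := (hasDerivAt_const (0 : ℝ) (0 : ℝ)).congr_of_eventuallyEq (f₁ := fun t : ℝ =>
      lam i (r + t • e) ^ n
        + ∑ k : Fin n, u k (r + t • e) * (((n - 1 - (k : ℕ) : ℕ) : ℝ) *
          lam i (r + t • e) ^ (n - 1 - (k : ℕ) - 1))) (by
      filter_upwards [hmem] with t ht
      have := hcrit _ ht i
      rw [hd] at this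
      exact this)
    have h6 := h3.unique h5
    simp only [zero_smul, add_zero, mul_zero, zero_add] at h6
    rw [hP, Polynomial.derivative_sum, Polynomial.eval_finsetSum, ← h6]
    refine Finset.sum_congr rfl fun k _ => ?_
    simp [Polynomial.derivative_X_pow]
  have hPb : P = Lagrange.basis univ (fun j => lam j r) i := by
    have hcard : (univ : Finset (Fin n)).card = n := by simp
    refine Polynomial.eq_of_degrees_lt_of_eval_index_eq (v := fun j => lam j r) univ
      hinj.injOn ?_ ?_ ?_
    · rw [hcard, hP]
      refine (Polynomial.degree_sum_le _ _).trans_lt ?_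
      refine (Finset.sup_lt_iff (WithBot.bot_lt_coe n)).2 ?_
      intro k _
      refine (Polynomial.degree_C_mul_X_pow_le _ _).trans_lt ?_
      have := k.2
      exact WithBot.coe_lt_coe.2 (by omega : n - 1 - (k : ℕ) < n)
    · rw [Lagrange.degree_basis hinj.injOn (mem_univ i), hcard]
      have := i.2
      exact_mod_cast (by omega : n - 1 < n)
    · intro j _
      rw [hPe]
      by_cases hij : i = j
      · subst hij
        rw [Lagrange.eval_basis_self (v := fun j => lam j r) hinj.injOn (mem_univ i)]
        simp [he]
      · rw [Lagrange.eval_basis_of_ne (v := fun j => lam j r) hij (mem_univ j)]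
        simp [he, Ne.symm hij]
  rw [hPb] at hPd
  rw [← hPd]
  exact (aux_basis_deriv (fun j => lam j r) hinj i).symm

/-- genuine nonlinearity of the extreme eigenvalues: in the
strictly hyperbolic region `λ₁ < λ₂ < … < λ_n` one has
`∂_{r₁} λ₁ ≠ 0` and `∂_{r_n} λ_n ≠ 0`. -/
theorem extreme_eigenvalues_genuinely_nonlinear
    (n : ℕ) (hn : 2 ≤ n)
    (Ω : Set (Fin n → ℝ)) (hΩ : IsOpen Ω)
    (u lam : Fin n → (Fin n → ℝ) → ℝ)
    (hu : ∀ k, ContDiffOn ℝ (⊤ : ℕ∞) (u k) Ω)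
    (hlam : ∀ i, ContDiffOn ℝ (⊤ : ℕ∞) (lam i) Ω)
    (F : (Fin n → ℝ) → ℝ → ℝ)
    (hF : ∀ r p, F r p =
      p ^ (n + 1) / ((n : ℝ) + 1) + ∑ k : Fin n, u k r * p ^ (n - 1 - (k : ℕ)))
    (horder : ∀ r ∈ Ω, ∀ i j : Fin n, i < j → lam i r < lam j r)
    (hcrit : ∀ r ∈ Ω, ∀ i, deriv (F r) (lam i r) = 0)
    (hval : ∀ r ∈ Ω, ∀ i, F r (lam i r) = r i) :
    ∀ r ∈ Ω,
      fderiv ℝ (lam ⟨0, by omega⟩) r (Pi.single (⟨0, by omega⟩ : Fin n) 1) ≠ 0 ∧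
      fderiv ℝ (lam ⟨n - 1, by omega⟩) r (Pi.single (⟨n - 1, by omega⟩ : Fin n) 1) ≠ 0 := by
  intro r hr
  have hinj : Function.Injective (fun j => lam j r) :=
    (show StrictMono (fun j => lam j r) from fun a b h => horder r hr a b h).injective
  refine ⟨fun h => ?_, fun h => ?_⟩
  · have := aux_main n Ω hΩ u lam hu hlam F hF hcrit hval r hr hinj _ h
    refine absurd this (ne_of_lt (Finset.sum_neg ?_ ⟨⟨1, by omega⟩, by simp⟩))
    intro j hj
    have hj' := (Finset.mem_erase.mp hj).1
    rw [Ne, Fin.ext_iff] at hj'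
    have := horder r hr ⟨0, by omega⟩ j (by rw [Fin.lt_def]; simp at hj' ⊢; omega)
    exact inv_lt_zero.mpr (by linarith)
  · have := aux_main n Ω hΩ u lam hu hlam F hF hcrit hval r hr hinj _ h
    refine absurd this (ne_of_gt (Finset.sum_pos ?_ ⟨⟨0, by omega⟩, by
      simp [Fin.ext_iff]; omega⟩))
    intro j hj
    have hj' := (Finset.mem_erase.mp hj).1
    rw [Ne, Fin.ext_iff] at hj'
    have hj2 := j.2
    have := horder r hr j ⟨n - 1, by omega⟩ (by rw [Fin.lt_def]; simp at hj' ⊢; omega)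
    exact inv_pos.mpr (by linarith)
end

section
/- (Exactness from the Gibbons–Tsarev conditions.) Define G_i(r) = −(1/2) log |∂_{r_i} u₁(r)| = (1/2) log |F_pp(r, λ_i(r))|. Then for every r ∈ Ω and all indices j ≠ i: ∂_{r_j} G_i(r) = − (∂_{r_j} u₁(r)) / (λ_i(r) − λ_j(r))² = (∂_{r_j} λ_i(r)) / (λ_i(r) − λ_j(r)). -/
open Polynomial in
lemma aux_poly (m : ℕ) (a w l : Fin (m+1) → ℝ) (hl : Function.Injective l) (j : Fin (m+1))
    (Q P' : ℝ[X]) (hQ : Q = ∑ k : Fin (m+1), C (a k) * X ^ (m - (k:ℕ)))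
    (hP : P' = X ^ (m+1) + ∑ k : Fin (m+1), C (w k) * derivative (X ^ (m - (k:ℕ))))
    (h0 : ∀ i, P'.eval (l i) = 0) (h1 : ∀ i, i ≠ j → Q.eval (l i) = 0) :
    (X - C (l j)) * Q = C (a 0) * P' := by
  rw [← sub_eq_zero]
  refine Polynomial.eq_zero_of_degree_lt_of_eval_index_eq_zero (s := Finset.univ) (v := l)
    hl.injOn ?_ ?_
  · rw [Finset.card_univ, Fintype.card_fin, ← Polynomial.mem_degreeLT]
    have hX : ∀ (c : ℝ) (e : ℕ), e < m + 1 → C c * X ^ e ∈ degreeLT ℝ (m+1) := by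
      intro c e he
      rw [mem_degreeLT]
      exact lt_of_le_of_lt (degree_C_mul_X_pow_le _ _) (by exact_mod_cast he)
    have key : (X - C (l j)) * Q - C (a 0) * P' =
        (∑ k : Fin m, C (a k.succ) * X ^ (m - (k.succ : ℕ) + 1))
        - ∑ k : Fin (m+1), C (l j * a k) * X ^ (m - (k:ℕ))
        - ∑ k : Fin (m+1), C (a 0 * w k * ((m - (k:ℕ) : ℕ) : ℝ)) * X ^ (m - (k:ℕ) - 1) := by
      have e1 : X * Q = C (a 0) * X ^ (m+1) +
          ∑ k : Fin m, C (a k.succ) * X ^ (m - (k.succ : ℕ) + 1) := by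
        rw [hQ, Fin.sum_univ_succ, mul_add, Finset.mul_sum]
        congr 1
        · simp; ring
        · exact Finset.sum_congr rfl fun k _ => by ring
      have e2 : C (l j) * Q = ∑ k : Fin (m+1), C (l j * a k) * X ^ (m - (k:ℕ)) := by
        rw [hQ, Finset.mul_sum]
        exact Finset.sum_congr rfl fun k _ => by rw [C_mul]; ring
      have e3 : C (a 0) * P' = C (a 0) * X ^ (m+1) +
          ∑ k : Fin (m+1), C (a 0 * w k * ((m - (k:ℕ) : ℕ) : ℝ)) * X ^ (m - (k:ℕ) - 1) := by
        rw [hP, mul_add, Finset.mul_sum]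
        congr 1
        exact Finset.sum_congr rfl fun k _ => by
          rw [derivative_X_pow, C_mul, C_mul]; ring
      rw [sub_mul, e1, e2, e3]; ring
    rw [key]
    refine Submodule.sub_mem _ (Submodule.sub_mem _ ?_ ?_) ?_
    · refine Submodule.sum_mem _ fun k _ => hX _ _ ?_
      have := k.2
      simp only [Fin.val_succ]; omega
    · exact Submodule.sum_mem _ fun k _ => hX _ _ (by omega)
    · exact Submodule.sum_mem _ fun k _ => hX _ _ (by omega)
  · intro i _
    by_cases h : i = j
    · subst h; simp [h0]
    · simp [h0, h1 i h]

open Polynomial in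
lemma aux_deriv {E : Type*} [NormedAddCommGroup E] [NormedSpace ℝ E] (m : ℕ)
    (C0 : ℝ[X]) (M : Fin m → ℝ[X]) (u : Fin m → E → ℝ) (l : E → ℝ) (r : E)
    (hu : ∀ k, DifferentiableAt ℝ (u k) r) (hl : DifferentiableAt ℝ l r) :
    DifferentiableAt ℝ (fun s => (C0 + ∑ k, C (u k s) * M k).eval (l s)) r ∧
    ∀ v, fderiv ℝ (fun s => (C0 + ∑ k, C (u k s) * M k).eval (l s)) r v =
      (∑ k, C (fderiv ℝ (u k) r v) * M k).eval (l r) +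
      (derivative (C0 + ∑ k, C (u k r) * M k)).eval (l r) * fderiv ℝ l r v := by
  have hp : ∀ p : ℝ[X], HasFDerivAt (fun s => p.eval (l s))
      ((derivative p).eval (l r) • fderiv ℝ l r) r := fun p =>
    (p.hasDerivAt (l r)).comp_hasFDerivAt r hl.hasFDerivAt
  have h : HasFDerivAt (fun s => (C0 + ∑ k, C (u k s) * M k).eval (l s))
      ((derivative C0).eval (l r) • fderiv ℝ l r + ∑ k, (u k r • ((derivative (M k)).eval (l r) •
        fderiv ℝ l r) + (M k).eval (l r) • fderiv ℝ (u k) r)) r := by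
    simp only [eval_add, eval_finsetSum, eval_mul, eval_C]
    refine (hp C0).add (HasFDerivAt.fun_sum fun k _ => ?_)
    exact (hu k).hasFDerivAt.mul (hp (M k))
  refine ⟨h.differentiableAt, fun v => ?_⟩
  rw [h.fderiv]
  simp [eval_finsetSum, Finset.sum_add_distrib, add_mul, Finset.sum_mul]
  simp only [mul_comm (eval (l r) (M _)), mul_assoc]
  ring

open Polynomial in
/-- exactness coming from the Gibbons–Tsarev conditions: with
`Gᵢ = -(1/2) log |∂_{rᵢ} u₁| = (1/2) log |F_pp(λᵢ)|` one has, for `j ≠ i`,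
`∂_{rⱼ} Gᵢ = -(∂_{rⱼ} u₁)/(λᵢ - λⱼ)² = (∂_{rⱼ} λᵢ)/(λᵢ - λⱼ)`. -/
theorem exactness_from_gibbons_tsarev
    (n : ℕ) (hn : 2 ≤ n)
    (Ω : Set (Fin n → ℝ)) (hΩ : IsOpen Ω)
    (u lam : Fin n → (Fin n → ℝ) → ℝ)
    (hu : ∀ k, ContDiffOn ℝ (⊤ : ℕ∞) (u k) Ω)
    (hlam : ∀ i, ContDiffOn ℝ (⊤ : ℕ∞) (lam i) Ω)
    (F : (Fin n → ℝ) → ℝ → ℝ)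
    (hF : ∀ r p, F r p =
      p ^ (n + 1) / ((n : ℝ) + 1) + ∑ k : Fin n, u k r * p ^ (n - 1 - (k : ℕ)))
    (hdist : ∀ r ∈ Ω, ∀ i j : Fin n, i ≠ j → lam i r ≠ lam j r)
    (hcrit : ∀ r ∈ Ω, ∀ i, deriv (F r) (lam i r) = 0)
    (hval : ∀ r ∈ Ω, ∀ i, F r (lam i r) = r i)
    (G : Fin n → (Fin n → ℝ) → ℝ)
    (hG : ∀ i r, G i r =
      -(1 / 2) * Real.log |fderiv ℝ (u ⟨0, by omega⟩) r (Pi.single i 1)|) :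
    ∀ r ∈ Ω, ∀ i : Fin n,
      G i r = (1 / 2) * Real.log |deriv (deriv (F r)) (lam i r)| ∧
      ∀ j : Fin n, j ≠ i →
        fderiv ℝ (G i) r (Pi.single j 1) =
          -(fderiv ℝ (u ⟨0, by omega⟩) r (Pi.single j 1)) / (lam i r - lam j r) ^ 2 ∧
        fderiv ℝ (G i) r (Pi.single j 1) =
          fderiv ℝ (lam i) r (Pi.single j 1) / (lam i r - lam j r) := by
  obtain ⟨m, rfl⟩ : ∃ m, n = m + 1 := ⟨n - 1, by omega⟩
  simp only [Nat.add_sub_cancel] at hF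
  have hz : (⟨0, by omega⟩ : Fin (m+1)) = 0 := rfl
  simp only [hz] at hG ⊢
  -- the polynomial and its derivatives
  let M : Fin (m+1) → Polynomial ℝ := fun k => X ^ (m - (k:ℕ))
  let C0 : Polynomial ℝ := C (1 / ((m:ℝ) + 2)) * X ^ (m + 2)
  let P : (Fin (m+1) → ℝ) → Polynomial ℝ := fun s => C0 + ∑ k, C (u k s) * M k
  have hFP : ∀ s, F s = fun p => (P s).eval p := by
    intro s; funext p
    rw [hF]
    simp only [P, C0, M, eval_add, eval_finsetSum, eval_mul, eval_C, eval_pow, eval_X]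
    push_cast
    ring
  have hF1 : ∀ s, deriv (F s) = fun p => (derivative (P s)).eval p := by
    intro s; rw [hFP]; funext p; exact Polynomial.deriv _
  have hF2 : ∀ s, deriv (deriv (F s)) = fun p => (derivative (derivative (P s))).eval p := by
    intro s; rw [hF1]; funext p; exact Polynomial.deriv _
  have hP1 : ∀ s, derivative (P s) = derivative C0 + ∑ k, C (u k s) * derivative (M k) := by
    intro s; simp [P]
  have hP2 : ∀ s, derivative (derivative (P s)) =
      derivative (derivative C0) + ∑ k, C (u k s) * derivative (derivative (M k)) := by
    intro s; simp [hP1]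
  have hC0 : derivative C0 = X ^ (m+1) := by
    simp only [C0, derivative_C_mul_X_pow]
    have : (1 / ((m:ℝ) + 2)) * ((m + 2 : ℕ) : ℝ) = 1 := by
      push_cast
      have : (m:ℝ) + 2 ≠ 0 := by positivity
      field_simp
    rw [this]; simp
  let Q : (Fin (m+1) → ℝ) → Fin (m+1) → Polynomial ℝ := fun s j =>
    ∑ k, C (fderiv ℝ (u k) s (Pi.single j 1)) * M k
  have hQ1 : ∀ s j, derivative (Q s j) =
      ∑ k, C (fderiv ℝ (u k) s (Pi.single j 1)) * derivative (M k) := by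
    intro s j; simp [Q]
  have hQ2 : ∀ s j, derivative (derivative (Q s j)) =
      ∑ k, C (fderiv ℝ (u k) s (Pi.single j 1)) * derivative (derivative (M k)) := by
    intro s j; simp [hQ1]
  have hud : ∀ s ∈ Ω, ∀ k, DifferentiableAt ℝ (u k) s := fun s hs k =>
    ((hu k).contDiffAt (hΩ.mem_nhds hs)).differentiableAt (by simp)
  have hld : ∀ s ∈ Ω, ∀ k, DifferentiableAt ℝ (lam k) s := fun s hs k =>
    ((hlam k).contDiffAt (hΩ.mem_nhds hs)).differentiableAt (by simp)
  have hcrit' : ∀ s ∈ Ω, ∀ i, (derivative (P s)).eval (lam i s) = 0 := by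
    intro s hs i; have := hcrit s hs i; rwa [hF1] at this
  have hQv : ∀ s ∈ Ω, ∀ i j, (Q s j).eval (lam i s) = (Pi.single j 1 : Fin (m+1) → ℝ) i := by
    intro s hs i j
    have h := (aux_deriv (m+1) C0 M u (lam i) s (hud s hs) (hld s hs i)).2 (Pi.single j 1)
    have he : (fun t => (C0 + ∑ k, C (u k t) * M k).eval (lam i t)) =ᶠ[nhds s] fun t => t i := by
      filter_upwards [hΩ.mem_nhds hs] with t ht
      have := hval t ht i
      rwa [hFP] at this
    rw [he.fderiv_eq] at h
    have h3 : (derivative (C0 + ∑ k, C (u k s) * M k)).eval (lam i s) = 0 := hcrit' s hs i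
    rw [h3, zero_mul, add_zero, (hasFDerivAt_apply i s).fderiv] at h
    exact h.symm
  have hid : ∀ s ∈ Ω, ∀ j, (X - C (lam j s)) * Q s j =
      C (fderiv ℝ (u 0) s (Pi.single j 1)) * derivative (P s) := by
    intro s hs j
    refine aux_poly m (fun k => fderiv ℝ (u k) s (Pi.single j 1)) (fun k => u k s)
      (fun k => lam k s) ?_ j (Q s j) (derivative (P s)) rfl ?_ (hcrit' s hs) ?_
    · intro a b hab
      by_contra hne
      exact hdist s hs a b hne hab
    · rw [hP1, hC0]
    · intro i hi
      rw [hQv s hs, Pi.single_eq_of_ne hi]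
  have hid1 : ∀ s ∈ Ω, ∀ j, Q s j + (X - C (lam j s)) * derivative (Q s j) =
      C (fderiv ℝ (u 0) s (Pi.single j 1)) * derivative (derivative (P s)) := by
    intro s hs j
    have := congrArg derivative (hid s hs j)
    simpa [derivative_mul] using this
  have hid2 : ∀ s ∈ Ω, ∀ j, 2 * derivative (Q s j) +
      (X - C (lam j s)) * derivative (derivative (Q s j)) =
      C (fderiv ℝ (u 0) s (Pi.single j 1)) * derivative (derivative (derivative (P s))) := by
    intro s hs j
    have := congrArg derivative (hid1 s hs j)
    simp only [derivative_mul, derivative_add, derivative_sub, derivative_X, derivative_C,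
      sub_zero, one_mul, zero_mul, zero_add] at this
    rw [← this]; ring
  have hone : ∀ s ∈ Ω, ∀ i, fderiv ℝ (u 0) s (Pi.single i 1) *
      (derivative (derivative (P s))).eval (lam i s) = 1 := by
    intro s hs i
    have := congrArg (eval (lam i s)) (hid1 s hs i)
    simp only [eval_add, eval_mul, eval_sub, eval_X, eval_C, sub_self, zero_mul, add_zero,
      hQv s hs, Pi.single_eq_same] at this
    exact this.symm
  have hGP : ∀ s ∈ Ω, ∀ i, G i s =
      (1/2) * Real.log ((derivative (derivative (P s))).eval (lam i s)) := by
    intro s hs i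
    rw [hG, eq_inv_of_mul_eq_one_left (hone s hs i), Real.log_abs, Real.log_inv]
    ring
  intro r hr i
  refine ⟨by rw [hGP r hr, hF2, Real.log_abs], fun j hj => ?_⟩
  have hd : lam i r - lam j r ≠ 0 := sub_ne_zero.2 (hdist r hr i j hj.symm)
  have hF2ne : (derivative (derivative (P r))).eval (lam i r) ≠ 0 :=
    right_ne_zero_of_mul_eq_one (hone r hr i)
  have a1 := congrArg (eval (lam i r)) (hid1 r hr j)
  have a2 := congrArg (eval (lam i r)) (hid2 r hr j)
  simp only [eval_add, eval_mul, eval_sub, eval_X, eval_C, hQv r hr, eval_ofNat,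
    Pi.single_eq_of_ne hj.symm, zero_add] at a1 a2
  have b1 : (derivative (Q r j)).eval (lam i r) +
      (derivative (derivative (P r))).eval (lam i r) * fderiv ℝ (lam i) r (Pi.single j 1) = 0 := by
    have h := (aux_deriv (m+1) (derivative C0) (fun k => derivative (M k)) u (lam i) r
      (hud r hr) (hld r hr i)).2 (Pi.single j 1)
    simp only [← hP1, ← hQ1] at h
    rw [← h]
    have he : (fun t => (derivative (P t)).eval (lam i t)) =ᶠ[nhds r] fun t => 0 := by
      filter_upwards [hΩ.mem_nhds hr] with t ht using hcrit' t ht i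
    rw [he.fderiv_eq]; simp
  have b2 := aux_deriv (m+1) (derivative (derivative C0)) (fun k => derivative (derivative (M k)))
    u (lam i) r (hud r hr) (hld r hr i)
  simp only [← hP2] at b2
  have b3 := b2.2 (Pi.single j 1)
  simp only [← hQ2] at b3
  have hGd : fderiv ℝ (G i) r (Pi.single j 1) = (1/2) *
      (((derivative (derivative (P r))).eval (lam i r))⁻¹ *
      fderiv ℝ (fun s => (derivative (derivative (P s))).eval (lam i s)) r (Pi.single j 1)) := by
    have he : G i =ᶠ[nhds r] fun s =>
        (1/2) * Real.log ((derivative (derivative (P s))).eval (lam i s)) := by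
      filter_upwards [hΩ.mem_nhds hr] with t ht using hGP t ht i
    rw [he.fderiv_eq, ((b2.1.hasFDerivAt.log hF2ne).const_mul (1/2)).fderiv]
    simp
  rw [hGd, b3]
  generalize (derivative (derivative (derivative (P r)))).eval (lam i r) = F3 at *
  generalize (derivative (derivative (P r))).eval (lam i r) = F2 at *
  generalize (derivative (derivative (Q r j))).eval (lam i r) = q2 at *
  generalize (derivative (Q r j)).eval (lam i r) = q1 at *
  generalize fderiv ℝ (lam i) r (Pi.single j 1) = x at *
  generalize fderiv ℝ (u 0) r (Pi.single j 1) = c at *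
  generalize lam i r - lam j r = d at *
  have hc : c = - (d * x) := by
    apply mul_right_cancel₀ hF2ne
    linear_combination -a1 + d * b1
  have hN : d * (q2 + F3 * x) = 2 * F2 * x := by
    subst hc
    linear_combination a2 - 2 * b1
  have hN' : q2 + F3 * x = 2 * F2 * x / d := by
    rw [eq_div_iff hd]; linear_combination hN
  rw [hN', hc]
  constructor <;> field_simp
end

section
/- For every r ∈ Ω, every i = 1,…,n, and every p ∈ ℝ, the following polynomial identity in p holds: (∂_{r_i} F)(r,p) · (p − λ_i(r)) = (∂_{r_i} u₁(r)) · (∂_p F)(r,p). -/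
open Finset

lemma aux_poly_s8 (m : ℕ) (a v : Fin (m+1) → ℝ) (l : Fin (m+1) → ℝ) (hl : Function.Injective l)
    (i : Fin (m+1))
    (hD : ∀ j, l j ^ (m+1) + ∑ k : Fin (m+1), v k * (((m - (k:ℕ) : ℕ) : ℝ) * l j ^ (m - (k:ℕ) - 1)) = 0)
    (hG : ∀ j, j ≠ i → ∑ k : Fin (m+1), a k * l j ^ (m - (k:ℕ)) = 0) (p : ℝ) :
    (∑ k : Fin (m+1), a k * p ^ (m - (k:ℕ))) * (p - l i) =
      a 0 * (p ^ (m+1) + ∑ k : Fin (m+1), v k * (((m - (k:ℕ) : ℕ) : ℝ) * p ^ (m - (k:ℕ) - 1))) := by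
  let H : Polynomial ℝ :=
    (∑ k : Fin m, Polynomial.C (a k.succ) * Polynomial.X ^ (m - (k:ℕ)))
    - Polynomial.C (l i) * (∑ k : Fin (m+1), Polynomial.C (a k) * Polynomial.X ^ (m - (k:ℕ)))
    - Polynomial.C (a 0) * ∑ k : Fin (m+1),
        Polynomial.C (v k * ((m - (k:ℕ) : ℕ) : ℝ)) * Polynomial.X ^ (m - (k:ℕ) - 1)
  have hev : ∀ q, H.eval q = (∑ k : Fin (m+1), a k * q ^ (m - (k:ℕ))) * (q - l i) -
      a 0 * (q ^ (m+1) + ∑ k : Fin (m+1), v k * (((m - (k:ℕ) : ℕ) : ℝ) * q ^ (m - (k:ℕ) - 1))) := by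
    intro q
    have e1 : (∑ k : Fin (m+1), a k * q ^ (m - (k:ℕ))) * q
        = a 0 * q ^ (m+1) + ∑ k : Fin m, a k.succ * q ^ (m - (k:ℕ)) := by
      rw [Fin.sum_univ_succ, add_mul, Finset.sum_mul]
      congr 1
      · simp [pow_succ, mul_assoc]
      · refine Finset.sum_congr rfl fun k _ => ?_
        rw [mul_assoc, ← pow_succ]
        congr 2
        have := k.2
        simp only [Fin.val_succ]
        omega
    rw [mul_sub, e1]
    simp only [H, Polynomial.eval_sub, Polynomial.eval_mul, Polynomial.eval_C,
      Polynomial.eval_finsetSum, Polynomial.eval_pow, Polynomial.eval_X, mul_assoc]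
    ring
  have hmono : ∀ (c : ℝ) (d : ℕ), d < m+1 →
      Polynomial.C c * Polynomial.X ^ d ∈ Polynomial.degreeLT ℝ (m+1) := by
    intro c d hd
    rw [Polynomial.mem_degreeLT]
    exact (Polynomial.degree_C_mul_X_pow_le d c).trans_lt (by exact_mod_cast hd)
  have hdeg : H ∈ Polynomial.degreeLT ℝ (m+1) := by
    refine Submodule.sub_mem _ (Submodule.sub_mem _ ?_ ?_) ?_
    · exact Submodule.sum_mem _ fun k _ => hmono _ _ (by omega)
    · rw [← Polynomial.smul_eq_C_mul]
      exact Submodule.smul_mem _ _ (Submodule.sum_mem _ fun k _ => hmono _ _ (by omega))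
    · rw [← Polynomial.smul_eq_C_mul]
      exact Submodule.smul_mem _ _ (Submodule.sum_mem _ fun k _ => hmono _ _ (by omega))
  have hz : H = 0 := by
    apply Polynomial.eq_zero_of_natDegree_lt_card_of_eval_eq_zero H hl
    · intro j
      rw [hev, hD]
      by_cases h : j = i
      · simp [h]
      · simp [hG j h]
    · rw [Polynomial.mem_degreeLT] at hdeg
      rw [Fintype.card_fin]
      by_cases h0 : H = 0
      · simp [h0]
      · exact (Polynomial.natDegree_lt_iff_degree_lt h0).2 hdeg
  have := hev p
  rw [hz, Polynomial.eval_zero] at this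
  linarith

/-- the polynomial identity
`(∂_{rᵢ} F)(r,p) · (p - λᵢ(r)) = (∂_{rᵢ} u₁(r)) · (∂_p F)(r,p)` for all `p`. -/
theorem deriv_F_in_r_i_identity
    (n : ℕ) (hn : 2 ≤ n)
    (Ω : Set (Fin n → ℝ)) (hΩ : IsOpen Ω)
    (u lam : Fin n → (Fin n → ℝ) → ℝ)
    (hu : ∀ k, ContDiffOn ℝ (⊤ : ℕ∞) (u k) Ω)
    (hlam : ∀ i, ContDiffOn ℝ (⊤ : ℕ∞) (lam i) Ω)
    (F : (Fin n → ℝ) → ℝ → ℝ)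
    (hF : ∀ r p, F r p =
      p ^ (n + 1) / ((n : ℝ) + 1) + ∑ k : Fin n, u k r * p ^ (n - 1 - (k : ℕ)))
    (hdist : ∀ r ∈ Ω, ∀ i j : Fin n, i ≠ j → lam i r ≠ lam j r)
    (hcrit : ∀ r ∈ Ω, ∀ i, deriv (F r) (lam i r) = 0)
    (hval : ∀ r ∈ Ω, ∀ i, F r (lam i r) = r i) :
    ∀ r ∈ Ω, ∀ i : Fin n, ∀ p : ℝ,
      fderiv ℝ (fun x => F x p) r (Pi.single i 1) * (p - lam i r) =
        fderiv ℝ (u ⟨0, by omega⟩) r (Pi.single i 1) * deriv (F r) p := by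
  intro r hr i p
  obtain ⟨m, rfl⟩ : ∃ m, n = m + 1 := ⟨n - 1, by omega⟩
  simp only [Nat.add_sub_cancel] at hF
  have hud : ∀ k, DifferentiableAt ℝ (u k) r := fun k =>
    ((hu k).contDiffAt (hΩ.mem_nhds hr)).differentiableAt (by simp)
  have hld : ∀ k, DifferentiableAt ℝ (lam k) r := fun k =>
    ((hlam k).contDiffAt (hΩ.mem_nhds hr)).differentiableAt (by simp)
  have hne : ((m + 1 : ℕ) : ℝ) + 1 ≠ 0 := by positivity
  have hder : ∀ q, deriv (F r) q = q ^ (m+1) +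
      ∑ k : Fin (m+1), u k r * (((m - (k:ℕ) : ℕ) : ℝ) * q ^ (m - (k:ℕ) - 1)) := by
    intro q
    have h1 : HasDerivAt (fun q : ℝ => q ^ (m+1+1) / (((m+1:ℕ):ℝ)+1)
        + ∑ k : Fin (m+1), u k r * q ^ (m - (k:ℕ)))
        (((m+1+1:ℕ):ℝ) * q ^ (m+1) / (((m+1:ℕ):ℝ)+1) +
          ∑ k : Fin (m+1), u k r * (((m - (k:ℕ) : ℕ) : ℝ) * q ^ (m - (k:ℕ) - 1))) q :=
      ((hasDerivAt_pow _ q).div_const _).add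
        (HasDerivAt.fun_sum fun k _ => (hasDerivAt_pow _ q).const_mul _)
    rw [show F r = _ from funext (hF r), h1.deriv]
    congr 1
    rw [Nat.cast_succ (m+1)]
    field_simp
  set a : Fin (m+1) → ℝ := fun k => fderiv ℝ (u k) r (Pi.single i 1) with ha
  have hFr : ∀ q, fderiv ℝ (fun x => F x q) r (Pi.single i 1)
      = ∑ k : Fin (m+1), a k * q ^ (m - (k:ℕ)) := by
    intro q
    have h1 : HasFDerivAt (fun x => q ^ (m+1+1) / (((m+1:ℕ):ℝ)+1)
        + ∑ k : Fin (m+1), u k x * q ^ (m - (k:ℕ)))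
        (∑ k : Fin (m+1), q ^ (m - (k:ℕ)) • fderiv ℝ (u k) r) r :=
      (HasFDerivAt.fun_sum fun k _ => (hud k).hasFDerivAt.mul_const _).const_add _
    rw [show (fun x => F x q) = _ from funext fun x => hF x q, h1.fderiv]
    simp [ha, mul_comm]
  have hline : HasDerivAt (fun t : ℝ => r + t • (Pi.single i 1 : Fin (m+1) → ℝ))
      (Pi.single i 1) 0 := by
    simpa using ((hasDerivAt_id (0:ℝ)).smul_const (Pi.single i 1 : Fin (m+1) → ℝ)).const_add r
  have hr0 : r + (0:ℝ) • (Pi.single i 1 : Fin (m+1) → ℝ) = r := by simp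
  have hcomp : ∀ f : (Fin (m+1) → ℝ) → ℝ, DifferentiableAt ℝ f r →
      HasDerivAt (fun t : ℝ => f (r + t • (Pi.single i 1 : Fin (m+1) → ℝ)))
        (fderiv ℝ f r (Pi.single i 1)) 0 := by
    intro f hf
    exact HasFDerivAt.comp_hasDerivAt_of_eq (0:ℝ) hf.hasFDerivAt hline hr0.symm
  have hG : ∀ j, j ≠ i → ∑ k : Fin (m+1), a k * lam j r ^ (m - (k:ℕ)) = 0 := by
    intro j hj
    have hL := hcomp _ (hld j)
    have h1 := ((hL.fun_pow (m+1+1)).div_const (((m+1:ℕ):ℝ)+1)).add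
      (HasDerivAt.fun_sum (u := Finset.univ) fun (k : Fin (m+1)) _ =>
        (hcomp _ (hud k)).fun_mul (hL.fun_pow (m - (k:ℕ))))
    have h2 : HasDerivAt (fun t : ℝ => r j) 0 0 := hasDerivAt_const _ _
    have hev : ∀ᶠ t in nhds (0:ℝ), r + t • (Pi.single i 1 : Fin (m+1) → ℝ) ∈ Ω :=
      hline.continuousAt.eventually_mem (by rw [hr0]; exact hΩ.mem_nhds hr)
    have h4 := h1.unique (h2.congr_of_eventuallyEq (hev.mono fun t ht => by
      have := hval _ ht j
      rw [hF] at this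
      simpa [hj] using this))
    have h5 := hder (lam j r)
    rw [hcrit r hr j] at h5
    simp only [hr0, Finset.sum_add_distrib, Nat.add_sub_cancel] at h4
    have h6 : ∑ k : Fin (m+1), u k r * (((m - (k:ℕ) : ℕ) : ℝ) * lam j r ^ (m - (k:ℕ) - 1)
        * fderiv ℝ (lam j) r (Pi.single i 1)) = (∑ k : Fin (m+1), u k r *
        (((m - (k:ℕ) : ℕ) : ℝ) * lam j r ^ (m - (k:ℕ) - 1)))
        * fderiv ℝ (lam j) r (Pi.single i 1) := by
      rw [Finset.sum_mul]
      exact Finset.sum_congr rfl fun k _ => by ring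
    have h7 : ((m+1+1:ℕ):ℝ) * lam j r ^ (m+1) * fderiv ℝ (lam j) r (Pi.single i 1)
        / (((m+1:ℕ):ℝ)+1) = lam j r ^ (m+1) * fderiv ℝ (lam j) r (Pi.single i 1) := by
      rw [Nat.cast_succ (m+1)]
      field_simp
    rw [h6, h7] at h4
    simp only [ha]
    linear_combination h4 + fderiv ℝ (lam j) r (Pi.single i 1) * h5
  rw [hFr, hder]
  refine aux_poly_s8 m a (fun k => u k r) (fun k => lam k r) ?_ i ?_ hG p
  · intro x y hxy
    by_contra h
    exact hdist r hr x y h hxy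
  · intro j
    rw [← hder]
    exact hcrit r hr j
end

section
/- For every r ∈ Ω, every i = 1,…,n, and every p ∈ ℝ, the partial derivative of F in the coordinate r_i is the i-th Lagrange interpolation polynomial at the nodes λ₁(r),…,λ_n(r): (∂_{r_i} F)(r,p) = Π_{s ≠ i} (p − λ_s(r)) / (λ_i(r) − λ_s(r)). -/
open Finset

/-- `∂_{rᵢ} F` is the `i`-th Lagrange interpolation polynomial at
the nodes `λ₁(r), …, λ_n(r)`:
`(∂_{rᵢ} F)(r,p) = ∏_{s ≠ i} (p - λ_s(r)) / (λᵢ(r) - λ_s(r))`. -/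
theorem deriv_F_in_r_i_is_lagrange_polynomial
    (n : ℕ) (hn : 2 ≤ n)
    (Ω : Set (Fin n → ℝ)) (hΩ : IsOpen Ω)
    (u lam : Fin n → (Fin n → ℝ) → ℝ)
    (hu : ∀ k, ContDiffOn ℝ (⊤ : ℕ∞) (u k) Ω)
    (hlam : ∀ i, ContDiffOn ℝ (⊤ : ℕ∞) (lam i) Ω)
    (F : (Fin n → ℝ) → ℝ → ℝ)
    (hF : ∀ r p, F r p =
      p ^ (n + 1) / ((n : ℝ) + 1) + ∑ k : Fin n, u k r * p ^ (n - 1 - (k : ℕ)))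
    (hdist : ∀ r ∈ Ω, ∀ i j : Fin n, i ≠ j → lam i r ≠ lam j r)
    (hcrit : ∀ r ∈ Ω, ∀ i, deriv (F r) (lam i r) = 0)
    (hval : ∀ r ∈ Ω, ∀ i, F r (lam i r) = r i) :
    ∀ r ∈ Ω, ∀ i : Fin n, ∀ p : ℝ,
      fderiv ℝ (fun x => F x p) r (Pi.single i 1) =
        ∏ s ∈ univ.erase i, (p - lam s r) / (lam i r - lam s r) := by
  intro r hr i p
  have hΩn : Ω ∈ nhds r := hΩ.mem_nhds hr
  have hud : ∀ k, HasFDerivAt (u k) (fderiv ℝ (u k) r) r := fun k =>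
    (((hu k).contDiffAt hΩn).differentiableAt (by simp)).hasFDerivAt
  have hld : ∀ k, HasFDerivAt (lam k) (fderiv ℝ (lam k) r) r := fun k =>
    (((hlam k).contDiffAt hΩn).differentiableAt (by simp)).hasFDerivAt
  set e : Fin n → ℝ := Pi.single i 1 with he
  -- the derivative at fixed `p`
  have hG : ∀ q : ℝ, fderiv ℝ (fun x => F x q) r e =
      ∑ k : Fin n, fderiv ℝ (u k) r e * q ^ (n - 1 - (k : ℕ)) := by
    intro q
    have h1 : HasFDerivAt (fun x => F x q)
        (∑ k : Fin n, (q ^ (n - 1 - (k : ℕ))) • fderiv ℝ (u k) r) r := by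
      have : (fun x => F x q) = fun x => q ^ (n + 1) / ((n : ℝ) + 1) +
          ∑ k : Fin n, u k x * q ^ (n - 1 - (k : ℕ)) := by
        funext x; exact hF x q
      rw [this]
      refine HasFDerivAt.const_add _ ?_
      exact HasFDerivAt.fun_sum fun k _ => (hud k).mul_const _
    rw [h1.fderiv]
    simp [mul_comm]
  -- values at the nodes
  have hnode : ∀ j : Fin n,
      ∑ k : Fin n, fderiv ℝ (u k) r e * (lam j r) ^ (n - 1 - (k : ℕ)) =
        if j = i then 1 else 0 := by
    intro j
    have hline : HasDerivAt (fun t : ℝ => r + t • e) e 0 := by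
      simpa using ((hasDerivAt_id (0 : ℝ)).smul_const e).const_add r
    have hr0 : r + (0 : ℝ) • e = r := by simp
    have hU : ∀ k, HasDerivAt (fun t : ℝ => u k (r + t • e)) (fderiv ℝ (u k) r e) 0 := by
      intro k
      exact HasFDerivAt.comp_hasDerivAt (x := (0 : ℝ)) (f := fun t : ℝ => r + t • e)
        (l := u k) (by rw [hr0]; exact hud k) hline
    have hL : HasDerivAt (fun t : ℝ => lam j (r + t • e)) (fderiv ℝ (lam j) r e) 0 :=
      HasFDerivAt.comp_hasDerivAt (x := (0 : ℝ)) (f := fun t : ℝ => r + t • e)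
        (l := lam j) (by rw [hr0]; exact hld j) hline
    have hA := ((hL.fun_pow (n + 1)).div_const ((n : ℝ) + 1)).fun_add
      (HasDerivAt.fun_sum (u := univ) fun (k : Fin n) _ =>
        (hU k).fun_mul (hL.fun_pow (n - 1 - (k : ℕ))))
    have hB : HasDerivAt (fun t : ℝ => r j + t * e j) (e j) 0 := by
      simpa using ((hasDerivAt_id (0 : ℝ)).mul_const (e j)).const_add (r j)
    have hC :=
      (((hasDerivAt_id' (lam j r)).fun_pow (n + 1)).div_const ((n : ℝ) + 1)).fun_add
        (HasDerivAt.fun_sum (u := univ) fun (k : Fin n) _ =>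
          ((hasDerivAt_id' (lam j r)).fun_pow (n - 1 - (k : ℕ))).const_mul (u k r))
    have hFr : F r = fun q => q ^ (n + 1) / ((n : ℝ) + 1) +
          ∑ k : Fin n, u k r * q ^ (n - 1 - (k : ℕ)) := by
      funext q; exact hF r q
    have hC0 := hcrit r hr j
    rw [hFr, hC.deriv] at hC0
    have hev : (fun t : ℝ => r j + t * e j) =ᶠ[nhds 0] fun t : ℝ =>
        lam j (r + t • e) ^ (n + 1) / ((n : ℝ) + 1) +
          ∑ k : Fin n, u k (r + t • e) * lam j (r + t • e) ^ (n - 1 - (k : ℕ)) := by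
      have : ∀ᶠ t in nhds (0 : ℝ), r + t • e ∈ Ω :=
        hline.continuousAt.eventually_mem (by rw [hr0]; exact hΩn)
      filter_upwards [this] with t ht
      rw [← hF, hval _ ht j]
      simp
    have hD := (hA.congr_of_eventuallyEq hev).unique hB
    have hej : e j = if j = i then 1 else 0 := by
      simp [he, Pi.single_apply]
    rw [← hej, ← hD]
    simp only [zero_smul, add_zero]
    rw [Finset.sum_add_distrib]
    have key : (((n + 1 : ℕ) : ℝ) * lam j r ^ (n + 1 - 1) * fderiv ℝ (lam j) r e) / ((n : ℝ) + 1) +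
        ∑ k : Fin n, u k r * (((n - 1 - (k : ℕ) : ℕ) : ℝ) * lam j r ^ (n - 1 - (k : ℕ) - 1) *
          fderiv ℝ (lam j) r e) = 0 := by
      rw [← mul_zero (fderiv ℝ (lam j) r e), ← hC0, mul_add, Finset.mul_sum]
      congr 1
      · ring
      · exact Finset.sum_congr rfl fun k _ => by ring
    linarith
  rw [hG p]
  -- polynomial identity
  let P : Polynomial ℝ := ∑ k : Fin n,
    Polynomial.C (fderiv ℝ (u k) r e) * Polynomial.X ^ (n - 1 - (k : ℕ))
  have hPe : ∀ q, P.eval q =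
      ∑ k : Fin n, fderiv ℝ (u k) r e * q ^ (n - 1 - (k : ℕ)) := by
    intro q; simp [P, Polynomial.eval_finsetSum]
  have hinj : Set.InjOn (fun s => lam s r) (univ : Finset (Fin n)) := by
    intro a _ b _ hab
    by_contra h
    exact hdist r hr a b h hab
  have hPd : P.degree < (univ : Finset (Fin n)).card := by
    rw [Finset.card_univ, Fintype.card_fin]
    refine (Polynomial.degree_sum_le _ _).trans_lt ?_
    refine (Finset.sup_lt_iff (WithBot.bot_lt_coe n)).2 ?_
    intro k _
    refine (Polynomial.degree_C_mul_X_pow_le _ _).trans_lt ?_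
    exact WithBot.coe_lt_coe.2 (by omega : n - 1 - (k : ℕ) < n)
  have hQd : (Lagrange.basis univ (fun s => lam s r) i).degree <
      (univ : Finset (Fin n)).card := by
    rw [Lagrange.degree_basis hinj (mem_univ i)]
    rw [Finset.card_univ, Fintype.card_fin]
    exact_mod_cast (by omega : n - 1 < n)
  have hPQ : P = Lagrange.basis univ (fun s => lam s r) i := by
    refine Polynomial.eq_of_degrees_lt_of_eval_index_eq univ hinj hPd hQd ?_
    intro j _
    rw [hPe, hnode j]
    split_ifs with h
    · subst h
      exact (Lagrange.eval_basis_self hinj (mem_univ _)).symm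
    · exact (Lagrange.eval_basis_of_ne (v := fun s => lam s r) (Ne.symm h) (mem_univ _)).symm
  rw [← hPe, hPQ, Lagrange.basis, Polynomial.eval_prod]
  refine Finset.prod_congr rfl fun s _ => ?_
  simp [Lagrange.basisDivisor, div_eq_mul_inv, mul_comm]
end

section
/- Suppose n = 3, so that F(r,p) = p⁴/4 + u₁(r)p² + u₂(r)p + u₃(r), ∂_p F = p³ + 2u₁p + u₂, and λ₁(r) + λ₂(r) + λ₃(r) = 0 for all r ∈ Ω. Then for every r ∈ Ω and every i = 1,2,3: F_pp(r, λ_i(r)) = Π_{j ≠ i} (λ_i(r) − λ_j(r)) and ∂_{r_i} λ_i(r) = −3λ_i(r) / F_pp(r, λ_i(r))². -/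
open Finset

theorem aux_alg (a b c u v A B C L : ℝ) (hab : a ≠ b) (hac : a ≠ c) (hbc : b ≠ c)
    (hs : a + b + c = 0)
    (ha : a ^ 3 + 2 * u * a + v = 0) (hb : b ^ 3 + 2 * u * b + v = 0)
    (h1 : A * a ^ 2 + B * a + C = 1) (h2 : A * b ^ 2 + B * b + C = 0)
    (h3 : A * c ^ 2 + B * c + C = 0)
    (hL : (3 * a ^ 2 + 2 * u) * L + 2 * A * a + B = 0) :
    3 * a ^ 2 + 2 * u = (a - b) * (a - c) ∧ L = -3 * a / (3 * a ^ 2 + 2 * u) ^ 2 := by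
  have hc : c = -a - b := by linarith
  have hab' := sub_ne_zero.2 hab
  have hac' := sub_ne_zero.2 hac
  have hbc' := sub_ne_zero.2 hbc
  have e1 : a ^ 2 + a * b + b ^ 2 + 2 * u = 0 := by
    apply mul_left_cancel₀ hab'
    linear_combination ha - hb
  have e2 : 3 * a ^ 2 + 2 * u = (a - b) * (a - c) := by
    rw [hc]; linear_combination e1
  have e3 : A * (b + c) + B = 0 := by
    apply mul_left_cancel₀ hbc'
    linear_combination h2 - h3
  have e4 : A * ((a - b) * (a - c)) = 1 := by
    linear_combination h1 - h2 - (a - b) * e3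
  refine ⟨e2, ?_⟩
  rw [e2] at hL ⊢
  have hP : (a - b) * (a - c) ≠ 0 := mul_ne_zero hab' hac'
  rw [eq_div_iff (pow_ne_zero 2 hP)]
  have hB : B = A * a := by linear_combination e3 - A * hs
  linear_combination ((a - b) * (a - c)) * hL - 3 * a * e4 - ((a - b) * (a - c)) * hB

/-- the `n = 3` simplifications: `F_pp(λᵢ) = ∏_{j ≠ i} (λᵢ - λⱼ)`
and `∂_{rᵢ} λᵢ = -3λᵢ / F_pp(λᵢ)²`. -/
theorem n_eq_three_simplifications
    (Ω : Set (Fin 3 → ℝ)) (hΩ : IsOpen Ω)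
    (u₁ u₂ u₃ : (Fin 3 → ℝ) → ℝ) (lam : Fin 3 → (Fin 3 → ℝ) → ℝ)
    (hu₁ : ContDiffOn ℝ (⊤ : ℕ∞) u₁ Ω)
    (hu₂ : ContDiffOn ℝ (⊤ : ℕ∞) u₂ Ω)
    (hu₃ : ContDiffOn ℝ (⊤ : ℕ∞) u₃ Ω)
    (hlam : ∀ i, ContDiffOn ℝ (⊤ : ℕ∞) (lam i) Ω)
    (F : (Fin 3 → ℝ) → ℝ → ℝ)
    (hF : ∀ r p, F r p = p ^ 4 / 4 + u₁ r * p ^ 2 + u₂ r * p + u₃ r)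
    (hdist : ∀ r ∈ Ω, ∀ i j : Fin 3, i ≠ j → lam i r ≠ lam j r)
    (hcrit : ∀ r ∈ Ω, ∀ i, deriv (F r) (lam i r) = 0)
    (hval : ∀ r ∈ Ω, ∀ i, F r (lam i r) = r i)
    (hsum : ∀ r ∈ Ω, lam 0 r + lam 1 r + lam 2 r = 0) :
    ∀ r ∈ Ω, ∀ i : Fin 3,
      deriv (deriv (F r)) (lam i r) = ∏ j ∈ univ.erase i, (lam i r - lam j r) ∧
      fderiv ℝ (lam i) r (Pi.single i 1) =
        -3 * lam i r / (deriv (deriv (F r)) (lam i r)) ^ 2 := by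
  have hd1 : ∀ r p, HasDerivAt (F r) (p ^ 3 + 2 * u₁ r * p + u₂ r) p := by
    intro r p
    have : F r = fun p => p ^ 4 / 4 + u₁ r * p ^ 2 + u₂ r * p + u₃ r := funext (hF r)
    rw [this]
    have h := ((((hasDerivAt_id p).pow 4).div_const 4).add
      (((hasDerivAt_id p).pow 2).const_mul (u₁ r))).add ((hasDerivAt_id p).const_mul (u₂ r))
    refine (h.add_const (u₃ r)).congr_deriv ?_
    simp
    ring
  have hd1' : ∀ r, deriv (F r) = fun p => p ^ 3 + 2 * u₁ r * p + u₂ r :=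
    fun r => funext fun p => (hd1 r p).deriv
  have hd2 : ∀ r p, deriv (deriv (F r)) p = 3 * p ^ 2 + 2 * u₁ r := by
    intro r p
    rw [hd1' r]
    have h := (((hasDerivAt_id p).pow 3).add
      ((hasDerivAt_id p).const_mul (2 * u₁ r))).add_const (u₂ r)
    refine (h.congr_deriv ?_).deriv
    simp
  have hcr : ∀ r ∈ Ω, ∀ i, lam i r ^ 3 + 2 * u₁ r * lam i r + u₂ r = 0 := by
    intro r hr i
    have := hcrit r hr i
    rwa [hd1' r] at this
  intro r hr i
  have hline : ∀ f : (Fin 3 → ℝ) → ℝ, ContDiffOn ℝ (⊤ : ℕ∞) f Ω →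
      HasDerivAt (fun t : ℝ => f (r + t • Pi.single i (1 : ℝ)))
        (fderiv ℝ f r (Pi.single i 1)) 0 := by
    intro f hf
    have h := (hf.contDiffAt (hΩ.mem_nhds hr)).differentiableAt (by simp)
    exact h.hasFDerivAt.hasLineDerivAt _
  have hev : ∀ᶠ t : ℝ in nhds 0, r + t • Pi.single i (1 : ℝ) ∈ Ω := by
    have hc : Continuous fun t : ℝ => r + t • (Pi.single i (1 : ℝ) : Fin 3 → ℝ) := by fun_prop
    exact hc.continuousAt.eventually_mem (hΩ.mem_nhds (by simpa using hr))
  have h1 := hline u₁ hu₁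
  have h2 := hline u₂ hu₂
  have h3 := hline u₃ hu₃
  have hl := fun j => hline (lam j) (hlam j)
  have key : ∀ j, fderiv ℝ u₁ r (Pi.single i 1) * lam j r ^ 2
      + fderiv ℝ u₂ r (Pi.single i 1) * lam j r + fderiv ℝ u₃ r (Pi.single i 1)
      = (Pi.single i (1 : ℝ) : Fin 3 → ℝ) j := by
    intro j
    have hL := (((((hl j).pow 4).div_const 4).add (h1.mul ((hl j).pow 2))).add
      (h2.mul (hl j))).add h3
    have hR := ((hasDerivAt_id (0 : ℝ)).mul_const
      ((Pi.single i (1 : ℝ) : Fin 3 → ℝ) j)).const_add (r j)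
    have := hL.unique (hR.congr_of_eventuallyEq (hev.mono fun t ht => by
      have := hval _ ht j
      rw [hF] at this
      simpa using this))
    simp at this
    have hc := hcr r hr j
    linear_combination this - (fderiv ℝ (lam j) r (Pi.single i 1)) * hc
  have key2 : (3 * lam i r ^ 2 + 2 * u₁ r) * fderiv ℝ (lam i) r (Pi.single i 1)
      + 2 * fderiv ℝ u₁ r (Pi.single i 1) * lam i r + fderiv ℝ u₂ r (Pi.single i 1) = 0 := by
    have hL := (((hl i).pow 3).add ((h1.const_mul 2).mul (hl i))).add h2
    have hR' := (hasDerivAt_const (0 : ℝ) (0 : ℝ)).congr_of_eventuallyEq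
      (hev.mono fun t ht => hcr _ ht i)
    have := hL.unique hR'
    simp at this
    linear_combination this
  obtain ⟨j, k, hij, hik, hjk, he, hs⟩ : ∃ j k : Fin 3, i ≠ j ∧ i ≠ k ∧ j ≠ k ∧
      univ.erase i = {j, k} ∧ lam i r + lam j r + lam k r = 0 := by
    have hs := hsum r hr
    fin_cases i
    · exact ⟨1, 2, by decide, by decide, by decide, by decide, by simpa using hs⟩
    · exact ⟨0, 2, by decide, by decide, by decide, by decide, by simp; linarith⟩
    · exact ⟨0, 1, by decide, by decide, by decide, by decide, by simp; linarith⟩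
  have ki := key i
  have kj := key j
  have kk := key k
  rw [Pi.single_eq_same] at ki
  rw [Pi.single_eq_of_ne hij.symm] at kj
  rw [Pi.single_eq_of_ne hik.symm] at kk
  rw [hd2, he, prod_pair hjk]
  exact aux_alg _ _ _ _ _ _ _ _ _ (hdist r hr i j hij) (hdist r hr i k hik)
    (hdist r hr j k hjk) hs (hcr r hr i) (hcr r hr j) ki kj kk key2
end

section
/- (Riemann-invariant form.) Let D ⊆ ℝ² be open and let λ : D → ℝ be a smooth function such that (∂_p F)(λ(q,t), q, t) = 0 for all (q,t) ∈ D. Then the function r(q,t) := F(λ(q,t), q, t) satisfies the transport equation ∂_t r + λ(q,t) ∂_q r = 0 on D. -/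
/-- Riemann-invariant form: if `λ` is a smooth branch of
critical points of `p ↦ F(p,q,t)` on an open set `D`, then
`r(q,t) = F(λ(q,t),q,t)` satisfies `∂_t r + λ ∂_q r = 0` on `D`. -/
theorem riemann_invariant_transport
    (n : ℕ) (hn : 1 ≤ n)
    (u : Fin n → ℝ → ℝ → ℝ)
    (hu : ∀ k, ContDiff ℝ (⊤ : ℕ∞) (fun z : ℝ × ℝ => u k z.1 z.2))
    (F : ℝ → ℝ → ℝ → ℝ)
    (hF : ∀ p q t, F p q t =
      p ^ (n + 1) / ((n : ℝ) + 1) + ∑ k : Fin n, u k q t * p ^ (n - 1 - (k : ℕ)))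
    (hcons : ∀ p q t,
      deriv (fun s => F p q s) t + p * deriv (fun x => F p x t) q
        - deriv (fun x => u ⟨0, hn⟩ x t) q * deriv (fun y => F y q t) p = 0)
    (D : Set (ℝ × ℝ)) (hD : IsOpen D)
    (lam : ℝ → ℝ → ℝ)
    (hlam : ContDiffOn ℝ (⊤ : ℕ∞) (fun z : ℝ × ℝ => lam z.1 z.2) D)
    (hroot : ∀ q t, (q, t) ∈ D → deriv (fun p => F p q t) (lam q t) = 0)
    (r : ℝ → ℝ → ℝ)
    (hr : ∀ q t, r q t = F (lam q t) q t) :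
    ∀ q t, (q, t) ∈ D →
      deriv (fun s => r q s) t + lam q t * deriv (fun x => r x t) q = 0 := by
  intro q t hqt
  have hG : Differentiable ℝ (fun w : ℝ × ℝ × ℝ => F w.1 w.2.1 w.2.2) := by
    have e : (fun w : ℝ × ℝ × ℝ => F w.1 w.2.1 w.2.2) = fun w : ℝ × ℝ × ℝ =>
        w.1 ^ (n + 1) / ((n : ℝ) + 1)
          + ∑ k : Fin n, u k w.2.1 w.2.2 * w.1 ^ (n - 1 - (k : ℕ)) := by
      funext w; exact hF _ _ _
    rw [e]
    have h1 : ∀ k, Differentiable ℝ (fun w : ℝ × ℝ × ℝ => u k w.2.1 w.2.2) := fun k =>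
      ((hu k).differentiable (by simp)).comp (differentiable_snd)
    have h2 : ∀ m : ℕ, Differentiable ℝ (fun w : ℝ × ℝ × ℝ => w.1 ^ m) := fun m =>
      differentiable_fst.pow m
    simp only [div_eq_mul_inv]
    exact ((h2 _).mul_const _).add
      (Differentiable.fun_sum fun k _ => (h1 k).mul (h2 _))
  have hl : DifferentiableAt ℝ (fun z : ℝ × ℝ => lam z.1 z.2) (q, t) :=
    (hlam.contDiffAt (hD.mem_nhds hqt)).differentiableAt (by simp)
  have hlt : DifferentiableAt ℝ (fun s => lam q s) t :=
    hl.comp (f := fun s : ℝ => (q, s)) t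
      ((differentiableAt_const q).prodMk differentiableAt_id)
  have hlq : DifferentiableAt ℝ (fun x => lam x t) q :=
    hl.comp (f := fun x : ℝ => (x, t)) q
      (differentiableAt_id.prodMk (differentiableAt_const t))
  obtain ⟨L, hL⟩ := hG (lam q t, q, t)
  have key : ∀ (a b c : ℝ → ℝ) (a' b' c' s : ℝ), HasDerivAt a a' s → HasDerivAt b b' s →
      HasDerivAt c c' s → a s = lam q t → b s = q → c s = t →
      deriv (fun s => F (a s) (b s) (c s)) s = L (a', b', c') := by
    intro a b c a' b' c' s ha hb hc ea eb ec
    have hL' : HasFDerivAt (fun w : ℝ × ℝ × ℝ => F w.1 w.2.1 w.2.2) L (a s, b s, c s) := by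
      rw [ea, eb, ec]; exact hL
    exact (hL'.comp_hasDerivAt s (ha.prodMk (hb.prodMk hc))).deriv
  have k1 := key (fun _ => lam q t) (fun _ => q) (fun s => s) 0 0 1 t
    (hasDerivAt_const _ _) (hasDerivAt_const _ _) (hasDerivAt_id _) rfl rfl rfl
  have k2 := key (fun _ => lam q t) (fun s => s) (fun _ => t) 0 1 0 q
    (hasDerivAt_const _ _) (hasDerivAt_id _) (hasDerivAt_const _ _) rfl rfl rfl
  have k3 := key (fun s => s) (fun _ => q) (fun _ => t) 1 0 0 (lam q t)
    (hasDerivAt_id _) (hasDerivAt_const _ _) (hasDerivAt_const _ _) rfl rfl rfl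
  have k4 := key (fun s => lam q s) (fun _ => q) (fun s => s) _ 0 1 t
    hlt.hasDerivAt (hasDerivAt_const _ _) (hasDerivAt_id _) rfl rfl rfl
  have k5 := key (fun s => lam s t) (fun s => s) (fun _ => t) _ 1 0 q
    hlq.hasDerivAt (hasDerivAt_id _) (hasDerivAt_const _ _) rfl rfl rfl
  have hc := hcons (lam q t) q t
  have h0 := hroot q t hqt
  have lin : ∀ a b c : ℝ, L (a, b, c) = a * L (1, 0, 0) + b * L (0, 1, 0) + c * L (0, 0, 1) := by
    intro a b c
    have : ((a, b, c) : ℝ × ℝ × ℝ) = a • (1, 0, 0) + b • (0, 1, 0) + c • (0, 0, 1) := by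
      simp
    rw [this, map_add, map_add, map_smul, map_smul, map_smul]
    simp only [smul_eq_mul]
  simp only [hr]
  rw [k4, k5, lin, lin (deriv _ _) 1 0]
  rw [k1, k2, h0] at hc
  rw [k3] at h0
  rw [h0]
  linarith
end

section
/- Assume that for every (q,t) ∈ ℝ² the polynomial (∂_p F)(·, q, t) has n distinct real roots λ₁(q,t) < λ₂(q,t) < … < λ_n(q,t) (strict hyperbolicity everywhere); these roots are then smooth functions of (q,t). Then the Riemann invariants corresponding to the minimal and maximal eigenvalues, r₁(q,t) = F(λ₁(q,t), q, t) and r_n(q,t) = F(λ_n(q,t), q, t), are constant functions on ℝ². -/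
theorem aux_torus (f g : ℝ × ℝ → ℝ) (hf : ContDiff ℝ 1 f) (hg : ContDiff ℝ 1 g)
    (hf1 : ∀ x y, f (x + 1, y) = f (x, y)) (hg2 : ∀ x y, g (x, y + 1) = g (x, y))
    (h0 : ∀ z, 0 ≤ fderiv ℝ f z (1, 0) + fderiv ℝ g z (0, 1)) (z : ℝ × ℝ) :
    fderiv ℝ f z (1, 0) + fderiv ℝ g z (0, 1) = 0 := by
  obtain ⟨a, b⟩ := z
  have hcf : Continuous (fun z => fderiv ℝ f z (1, 0)) :=
    (hf.continuous_fderiv one_ne_zero).clm_apply continuous_const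
  have hcg : Continuous (fun z => fderiv ℝ g z (0, 1)) :=
    (hg.continuous_fderiv one_ne_zero).clm_apply continuous_const
  have hc := hcf.add hcg
  have key := MeasureTheory.integral2_divergence_prod_of_hasFDerivAt f g (fderiv ℝ f) (fderiv ℝ g)
    a b (a + 1) (b + 1) hf.continuous.continuousOn hg.continuous.continuousOn
    (fun x _ => (hf.differentiable one_ne_zero x).hasFDerivAt)
    (fun x _ => (hg.differentiable one_ne_zero x).hasFDerivAt)
    (hc.continuousOn.integrableOn_compact (isCompact_uIcc.prod isCompact_uIcc))
  simp only [hf1, hg2, sub_self, zero_add] at key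
  by_contra hne
  have hpos : 0 < fderiv ℝ f (a, b) (1, 0) + fderiv ℝ g (a, b) (0, 1) :=
    lt_of_le_of_ne (h0 _) (Ne.symm hne)
  have hcont : Continuous (fun x => ∫ y in b..(b+1),
      (fderiv ℝ f (x, y) (1, 0) + fderiv ℝ g (x, y) (0, 1))) :=
    intervalIntegral.continuous_parametric_intervalIntegral_of_continuous' (by exact hc) _ _
  have h1 : 0 < ∫ y in b..(b+1), (fderiv ℝ f (a, y) (1, 0) + fderiv ℝ g (a, y) (0, 1)) := by
    apply intervalIntegral.integral_pos (by linarith)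
    · exact (hc.comp (Continuous.prodMk_right a)).continuousOn
    · intro x _; exact h0 _
    · exact ⟨b, by simp, hpos⟩
  have h2 : 0 < ∫ x in a..(a+1), ∫ y in b..(b+1),
      (fderiv ℝ f (x, y) (1, 0) + fderiv ℝ g (x, y) (0, 1)) := by
    apply intervalIntegral.integral_pos (by linarith)
    · exact hcont.continuousOn
    · intro x _
      exact intervalIntegral.integral_nonneg (by linarith) (fun y _ => h0 _)
    · exact ⟨a, by simp, h1⟩
  linarith

theorem aux_core (r L A S : ℝ × ℝ → ℝ) (hr : ContDiff ℝ (⊤ : ℕ∞) r) (hL : ContDiff ℝ (⊤ : ℕ∞) L)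
    (hA : ContDiff ℝ (⊤ : ℕ∞) A)
    (hr1 : ∀ x y, r (x + 1, y) = r (x, y)) (hr2 : ∀ x y, r (x, y + 1) = r (x, y))
    (hL1 : ∀ x y, L (x + 1, y) = L (x, y))
    (hA1 : ∀ x y, A (x + 1, y) = A (x, y)) (hA2 : ∀ x y, A (x, y + 1) = A (x, y))
    (hrt : ∀ z, fderiv ℝ r z (0, 1) = - (L z * fderiv ℝ r z (1, 0)))
    (hAt : ∀ z, fderiv ℝ A z (0, 1) + L z * fderiv ℝ A z (1, 0) =
      2 * A z * fderiv ℝ L z (1, 0) + S z * fderiv ℝ r z (1, 0))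
    (σ : ℝ) (hS : ∀ z, 0 < σ * S z) : ∃ c, ∀ z, r z = c := by
  set w : ℝ × ℝ → ℝ := fun z => fderiv ℝ r z (1, 0) with hw
  have hr' : ContDiff ℝ (⊤ : ℕ∞) (fderiv ℝ r) := hr.fderiv_right (by simp)
  have hwc : ContDiff ℝ (⊤ : ℕ∞) w := hr'.clm_apply contDiff_const
  have hper1 : ∀ x y, fderiv ℝ r (x + 1, y) = fderiv ℝ r (x, y) := by
    intro x y
    have : (fun z : ℝ × ℝ => r (z + (1, 0))) = r := by
      funext ⟨a, b⟩; simp [hr1]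
    have h2 := fderiv_comp_add_right (𝕜 := ℝ) (f := r) (x := (x, y)) ((1, 0) : ℝ × ℝ)
    rw [this] at h2
    simpa using h2.symm
  have hper2 : ∀ x y, fderiv ℝ r (x, y + 1) = fderiv ℝ r (x, y) := by
    intro x y
    have : (fun z : ℝ × ℝ => r (z + (0, 1))) = r := by
      funext ⟨a, b⟩; simp [hr2]
    have h2 := fderiv_comp_add_right (𝕜 := ℝ) (f := r) (x := (x, y)) ((0, 1) : ℝ × ℝ)
    rw [this] at h2
    simpa using h2.symm
  have dL : Differentiable ℝ L := hL.differentiable (by simp)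
  have dA : Differentiable ℝ A := hA.differentiable (by simp)
  have dw : Differentiable ℝ w := hwc.differentiable (by simp)
  -- w_t + (L w)_q = 0
  have hwt : ∀ z, fderiv ℝ w z (0, 1) =
      - (L z * fderiv ℝ w z (1, 0) + w z * fderiv ℝ L z (1, 0)) := by
    intro z
    have hd : DifferentiableAt ℝ (fderiv ℝ r) z := hr'.differentiable (by simp) z
    have e1 : ∀ v v', fderiv ℝ (fun z => fderiv ℝ r z v) z v' = fderiv ℝ (fderiv ℝ r) z v' v := by
      intro v v'
      rw [fderiv_clm_apply hd (differentiableAt_const _)]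
      simp
    have sym := (hr.contDiffAt (x := z)).isSymmSndFDerivAt (by
      simp only [minSmoothness_of_isRCLikeNormedField]
      exact WithTop.coe_le_coe.2 (le_top : (2 : ℕ∞) ≤ ⊤)) (0, 1) (1, 0)
    rw [hw, e1, sym, ← e1]
    have : (fun z => fderiv ℝ r z (0, 1)) = fun z => - (L z * w z) := by
      funext z; exact hrt z
    rw [this]
    have h3 := ((dL z).hasFDerivAt.mul (dw z).hasFDerivAt).neg
    have h4 : fderiv ℝ (fun z => - (L z * w z)) z = _ := h3.fderiv
    rw [h4]
    simp [hw]
  set Z : ℝ × ℝ → ℝ := fun z => σ * (A z * w z ^ 3) with hZ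
  have hZc : ContDiff ℝ (⊤ : ℕ∞) Z := contDiff_const.mul (hA.mul (hwc.pow 3))
  have hZd : ∀ z v, fderiv ℝ Z z v = σ * (fderiv ℝ A z v * w z ^ 3 +
      A z * (3 * w z ^ 2 * fderiv ℝ w z v)) := by
    intro z v
    have h3 := ((dA z).hasFDerivAt.mul ((dw z).hasFDerivAt.pow 3)).const_mul σ
    have h4 : fderiv ℝ Z z = _ := h3.fderiv
    rw [h4]
    simp
    ring
  have hLZd : ∀ z v, fderiv ℝ (fun z => L z * Z z) z v =
      L z * fderiv ℝ Z z v + Z z * fderiv ℝ L z v := by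
    intro z v
    have h3 := ((dL z).hasFDerivAt.mul ((hZc.differentiable (by simp)) z).hasFDerivAt)
    have h4 : fderiv ℝ (fun z => L z * Z z) z = _ := h3.fderiv
    rw [h4]
    simp
  have hg : ∀ z, fderiv ℝ (fun z => L z * Z z) z (1, 0) + fderiv ℝ Z z (0, 1)
      = σ * S z * w z ^ 4 := by
    intro z
    rw [hLZd, hZd, hZd, hwt]
    have := hAt z
    have e : fderiv ℝ A z (0, 1) = 2 * A z * fderiv ℝ L z (1, 0) + S z * w z
      - L z * fderiv ℝ A z (1, 0) := by linarith
    rw [e, hZ]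
    ring
  have hle : (1 : WithTop ℕ∞) ≤ ((⊤ : ℕ∞) : WithTop ℕ∞) := by exact_mod_cast le_top
  have hz := aux_torus (fun z => L z * Z z) Z ((hL.mul hZc).of_le hle) (hZc.of_le hle)
    (by intro x y; simp [hZ, hw, hL1, hA1, hper1]) (by intro x y; simp [hZ, hw, hA2, hper2])
    (by intro z; rw [hg]; have := hS z; positivity)
  have hw0 : ∀ z, w z = 0 := by
    intro z
    have := hz z
    rw [hg] at this
    have h5 := (hS z).ne'
    rcases mul_eq_zero.1 this with h | h
    · exact absurd h h5
    · exact pow_eq_zero_iff (by norm_num) |>.1 h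
  have hconst : ∀ z, fderiv ℝ r z = 0 := by
    intro z
    ext
    · simpa [hw] using hw0 z
    · have := hrt z
      have h6 : fderiv ℝ r z (1, 0) = 0 := hw0 z
      simp [this, h6]
  exact ⟨r 0, fun z => is_const_of_fderiv_eq_zero (hr.differentiable (by simp)) hconst z 0⟩

namespace AuxRI
open Polynomial

noncomputable def auxPP {n : ℕ} (M : ℝ[X]) (R : Fin n → ℝ[X]) (c : Fin n → ℝ) : ℝ[X] :=
  M + ∑ k, C (c k) * R k

theorem auxPP_derivative {n : ℕ} (M : ℝ[X]) (R : Fin n → ℝ[X]) (c : Fin n → ℝ) :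
    derivative (auxPP M R c) = auxPP (derivative M) (fun k => derivative (R k)) c := by
  simp [auxPP, derivative_sum]

theorem auxPP_hasFDerivAt {n : ℕ} (M : ℝ[X]) (R : Fin n → ℝ[X]) (c : Fin n → ℝ × ℝ → ℝ)
    (L : ℝ × ℝ → ℝ) (z v : ℝ × ℝ) (hc : ∀ k, DifferentiableAt ℝ (c k) z)
    (hL : DifferentiableAt ℝ L z) :
    fderiv ℝ (fun z => eval (L z) (auxPP M R (fun k => c k z))) z v =
      eval (L z) (auxPP 0 R (fun k => fderiv ℝ (c k) z v)) +
      eval (L z) (derivative (auxPP M R (fun k => c k z))) * fderiv ℝ L z v := by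
  have hP : ∀ P : ℝ[X], HasFDerivAt (fun z => eval (L z) P)
      (eval (L z) (derivative P) • fderiv ℝ L z) z := fun P =>
    (P.hasDerivAt (L z)).comp_hasFDerivAt z hL.hasFDerivAt
  have h1 : HasFDerivAt (fun z => eval (L z) M + ∑ k, c k z * eval (L z) (R k)) _ z :=
    (hP M).add (HasFDerivAt.fun_sum (fun k (_ : k ∈ Finset.univ) =>
      (hc k).hasFDerivAt.mul (hP (R k))))
  have h2 : (fun z => eval (L z) (auxPP M R (fun k => c k z))) =
      (fun z => eval (L z) M + ∑ k, c k z * eval (L z) (R k)) := by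
    funext z; simp [auxPP, eval_finsetSum]
  rw [h2, h1.fderiv]
  simp [auxPP, eval_finsetSum, derivative_sum, Finset.sum_add_distrib, Finset.sum_mul, add_mul]
  have : ∀ a b c d : ℝ, b = d → a + (b + c) = c + (a + d) := by intros; linarith
  rw [← add_assoc]
  have e : ∀ x, c x z * (eval (L z) (derivative (R x)) * fderiv ℝ L z v) =
     c x z * eval (L z) (derivative (R x)) * fderiv ℝ L z v := fun x => by ring
  have e' : ∀ x, eval (L z) (R x) * fderiv ℝ (c x) z v =
     fderiv ℝ (c x) z v * eval (L z) (R x) := fun x => by ring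
  simp only [e, e']
  ring

theorem auxPP_contDiff {n : ℕ} (M : ℝ[X]) (R : Fin n → ℝ[X]) (c : Fin n → ℝ × ℝ → ℝ)
    (L : ℝ × ℝ → ℝ) (hc : ∀ k, ContDiff ℝ (⊤ : ℕ∞) (c k)) (hL : ContDiff ℝ (⊤ : ℕ∞) L) :
    ContDiff ℝ (⊤ : ℕ∞) (fun z => eval (L z) (auxPP M R (fun k => c k z))) := by
  have h2 : (fun z => eval (L z) (auxPP M R (fun k => c k z))) =
      (fun z => eval (L z) M + ∑ k, c k z * eval (L z) (R k)) := by
    funext z; simp [auxPP, eval_finsetSum]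
  have hP : ∀ P : ℝ[X], ContDiff ℝ (⊤ : ℕ∞) (fun z => eval (L z) P) := fun P => by
    have : ContDiff ℝ (⊤ : ℕ∞) (fun x => eval x P) := by
      simpa using P.contDiff_aeval (𝕜 := ℝ) (⊤ : ℕ∞)
    exact this.comp hL
  rw [h2]
  exact (hP M).add (ContDiff.sum fun k _ => (hc k).mul (hP (R k)))

/-- second derivative over first at a node. -/
theorem aux_nodal {n : ℕ} (v : Fin n → ℝ) (hv : StrictMono v) (i : Fin n) (G : ℝ[X])
    (hG : G = Lagrange.nodal Finset.univ v) :
    eval (v i) (derivative G) ≠ 0 ∧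
    eval (v i) (derivative (derivative G)) =
      eval (v i) (derivative G) * (2 * ∑ j ∈ Finset.univ.erase i, (v i - v j)⁻¹) := by
  have hne : ∀ j ∈ Finset.univ.erase i, v i - v j ≠ 0 := by
    intro j hj
    rw [sub_ne_zero]
    exact fun h => (Finset.ne_of_mem_erase hj) (hv.injective h).symm
  have h1 : G = (X - C (v i)) * Lagrange.nodal (Finset.univ.erase i) v := by
    rw [hG, Lagrange.nodal_eq_mul_nodal_erase (Finset.mem_univ i)]
  set H := Lagrange.nodal (Finset.univ.erase i) v with hH
  have e1 : eval (v i) (derivative G) = eval (v i) H := by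
    rw [h1]; simp [derivative_mul]
  have e2 : eval (v i) (derivative (derivative G)) = 2 * eval (v i) (derivative H) := by
    rw [h1]; simp [derivative_mul]; ring
  rw [e1, e2]
  constructor
  · rw [hH, Lagrange.eval_nodal]
    exact Finset.prod_ne_zero_iff.2 hne
  · rw [hH, Lagrange.derivative_nodal, eval_finsetSum]
    rw [mul_left_comm]
    congr 1
    rw [Finset.mul_sum]
    apply Finset.sum_congr rfl
    intro j hj
    rw [Lagrange.eval_nodal, Lagrange.eval_nodal, ← Finset.mul_prod_erase _ _ hj]
    have := hne j hj
    field_simp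

theorem aux_eq_nodal {n : ℕ} (hn : 2 ≤ n) (c : Fin n → ℝ) (v : Fin n → ℝ) (hv : StrictMono v)
    (G : ℝ[X])
    (hG : G = derivative (auxPP (C (1 / ((n : ℝ) + 1)) * X ^ (n + 1))
      (fun k : Fin n => X ^ (n - 1 - (k : ℕ))) c))
    (hr : ∀ i, eval (v i) G = 0) : G = Lagrange.nodal Finset.univ v := by
  have h0 : G = X ^ n + ∑ k : Fin n, C (c k) * derivative (X ^ (n - 1 - (k : ℕ))) := by
    rw [hG, auxPP_derivative, auxPP]
    congr 1
    have : (n : ℝ) + 1 ≠ 0 := by positivity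
    rw [derivative_C_mul, derivative_X_pow, ← mul_assoc, ← C_mul]
    simp [this]
  have hd : (∑ k : Fin n, C (c k) * derivative (X ^ (n - 1 - (k : ℕ)))).degree < (n : WithBot ℕ) := by
    rw [← mem_degreeLT]
    refine Submodule.sum_mem _ fun k _ => ?_
    rw [← smul_eq_C_mul]
    refine Submodule.smul_mem _ _ ?_
    rw [mem_degreeLT]
    refine lt_of_le_of_lt degree_derivative_le ?_
    rw [degree_X_pow]
    exact_mod_cast (by omega : n - 1 - (k : ℕ) < n)
  have hGd : G.degree = (n : WithBot ℕ) := by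
    rw [h0, degree_add_eq_left_of_degree_lt (by rwa [degree_X_pow]), degree_X_pow]
  have hGm : G.leadingCoeff = 1 := by
    rw [h0, leadingCoeff_add_of_degree_lt' (by rwa [degree_X_pow])]
    simp
  apply Polynomial.eq_of_degree_le_of_eval_index_eq (s := Finset.univ) (v := v)
  · exact hv.injective.injOn
  · rw [hGd]; simp
  · rw [hGd, Lagrange.degree_nodal]; simp
  · rw [hGm]; exact (Lagrange.nodal_monic).symm
  · intro i hi
    rw [hr, Lagrange.eval_nodal_at_node hi]

theorem aux_range {n : ℕ} (v : Fin n → ℝ) (G : ℝ[X]) (hG : G = Lagrange.nodal Finset.univ v) :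
    Set.range v = {x | eval x G = 0} := by
  ext x
  simp only [hG, Lagrange.eval_nodal, Set.mem_ofPred_eq, Finset.prod_eq_zero_iff, Set.mem_range,
    sub_eq_zero, Finset.mem_univ, true_and]
  exact ⟨fun ⟨i, h⟩ => ⟨i, h.symm⟩, fun ⟨i, h⟩ => ⟨i, h.symm⟩⟩

theorem aux_main
    (n : ℕ) (hn : 2 ≤ n) (k₀ : Fin n)
    (u : Fin n → ℝ → ℝ → ℝ)
    (hu : ∀ k, ContDiff ℝ (⊤ : ℕ∞) (fun z : ℝ × ℝ => u k z.1 z.2))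
    (huq : ∀ k t, Function.Periodic (fun q => u k q t) 1)
    (hut : ∀ k q, Function.Periodic (fun t => u k q t) 1)
    (F : ℝ → ℝ → ℝ → ℝ)
    (hF : ∀ p q t, F p q t =
      p ^ (n + 1) / ((n : ℝ) + 1) + ∑ k : Fin n, u k q t * p ^ (n - 1 - (k : ℕ)))
    (hcons : ∀ p q t,
      deriv (fun s => F p q s) t + p * deriv (fun x => F p x t) q
        - deriv (fun x => u k₀ x t) q * deriv (fun y => F y q t) p = 0)
    (lam : Fin n → ℝ → ℝ → ℝ)
    (hlam : ∀ i, ContDiff ℝ (⊤ : ℕ∞) (fun z : ℝ × ℝ => lam i z.1 z.2))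
    (hroot : ∀ i q t, deriv (fun p => F p q t) (lam i q t) = 0)
    (horder : ∀ q t, ∀ i j : Fin n, i < j → lam i q t < lam j q t)
    (i : Fin n) (σ : ℝ)
    (hσ : ∀ q t, 0 < σ * (2 * ∑ j ∈ Finset.univ.erase i, (lam i q t - lam j q t)⁻¹)) :
    ∃ c : ℝ, ∀ q t, F (lam i q t) q t = c := by
  set M : ℝ[X] := C (1 / ((n : ℝ) + 1)) * X ^ (n + 1) with hM
  set R : Fin n → ℝ[X] := fun k => X ^ (n - 1 - (k : ℕ)) with hR
  set c : Fin n → ℝ × ℝ → ℝ := fun k z => u k z.1 z.2 with hc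
  have hFe : ∀ p q t, F p q t = eval p (auxPP M R (fun k => c k (q, t))) := by
    intro p q t
    rw [hF]
    simp [auxPP, hM, hR, hc, eval_finsetSum, div_eq_inv_mul]
  have hmono : ∀ q t, StrictMono (fun j => lam j q t) := fun q t j k h => horder q t j k h
  have dc : ∀ k z, DifferentiableAt ℝ (c k) z := fun k z => (hu k).differentiable (by simp) z
  -- derivatives of F
  have hFp : ∀ p q t, deriv (fun y => F y q t) p =
      eval p (derivative (auxPP M R (fun k => c k (q, t)))) := by
    intro p q t
    simp only [hFe]
    exact Polynomial.deriv _
  have hline1 : ∀ (f : ℝ × ℝ → ℝ) q t, DifferentiableAt ℝ f (q, t) →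
      deriv (fun x => f (x, t)) q = fderiv ℝ f (q, t) (1, 0) := by
    intro f q t h
    exact (h.hasFDerivAt.comp_hasDerivAt q
      ((hasDerivAt_id q).prodMk (hasDerivAt_const q t))).deriv
  have hline2 : ∀ (f : ℝ × ℝ → ℝ) q t, DifferentiableAt ℝ f (q, t) →
      deriv (fun x => f (q, x)) t = fderiv ℝ f (q, t) (0, 1) := by
    intro f q t h
    exact (h.hasFDerivAt.comp_hasDerivAt t
      ((hasDerivAt_const t q).prodMk (hasDerivAt_id t))).deriv
  have dF : ∀ p z, DifferentiableAt ℝ (fun z => eval p (auxPP M R (fun k => c k z))) z :=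
    fun p z => (auxPP_contDiff M R c (fun _ => p) hu contDiff_const).differentiable (by simp) z
  have hFq : ∀ p q t, deriv (fun x => F p x t) q =
      eval p (auxPP 0 R (fun k => fderiv ℝ (c k) (q, t) (1, 0))) := by
    intro p q t
    simp only [hFe]
    rw [hline1 (fun z => eval p (auxPP M R (fun k => c k z))) q t (dF p _),
      auxPP_hasFDerivAt M R c (fun _ => p) (q, t) _ (fun k => dc k _) (differentiableAt_const _)]
    simp
  have hFt : ∀ p q t, deriv (fun x => F p q x) t =
      eval p (auxPP 0 R (fun k => fderiv ℝ (c k) (q, t) (0, 1))) := by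
    intro p q t
    simp only [hFe]
    rw [hline2 (fun z => eval p (auxPP M R (fun k => c k z))) q t (dF p _),
      auxPP_hasFDerivAt M R c (fun _ => p) (q, t) _ (fun k => dc k _) (differentiableAt_const _)]
    simp
  -- polynomial conservation law
  have hpoly : ∀ z : ℝ × ℝ, ∃ b : ℝ, auxPP 0 R (fun k => fderiv ℝ (c k) z (0, 1)) +
      X * auxPP 0 R (fun k => fderiv ℝ (c k) z (1, 0)) -
      C b * derivative (auxPP M R (fun k => c k z)) = 0 := by
    rintro ⟨q, t⟩
    refine ⟨deriv (fun x => u k₀ x t) q, ?_⟩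
    apply Polynomial.funext
    intro p
    have := hcons p q t
    rw [hFp, hFq, hFt] at this
    simpa using this
  -- nodal
  have hroot' : ∀ j q t, eval (lam j q t) (derivative (auxPP M R (fun k => c k (q, t)))) = 0 := by
    intro j q t
    rw [← hFp]; exact hroot j q t
  have hnod : ∀ q t, derivative (auxPP M R (fun k => c k (q, t))) =
      Lagrange.nodal Finset.univ (fun j => lam j q t) := fun q t =>
    aux_eq_nodal hn _ _ (hmono q t) _ rfl (fun j => hroot' j q t)
  have hc1 : ∀ k q t, c k (q + 1, t) = c k (q, t) := fun k q t => huq k t q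
  have hc2 : ∀ k q t, c k (q, t + 1) = c k (q, t) := fun k q t => hut k q t
  have hl1 : ∀ q t, lam i (q + 1) t = lam i q t := by
    intro q t
    have h1 := aux_range _ _ (hnod (q + 1) t)
    simp only [hc1] at h1
    rw [← aux_range _ _ (hnod q t)] at h1
    exact congrFun (((hmono (q + 1) t).range_inj (hmono q t)).1 h1) i
  have hl2 : ∀ q t, lam i q (t + 1) = lam i q t := by
    intro q t
    have h1 := aux_range _ _ (hnod q (t + 1))
    simp only [hc2] at h1
    rw [← aux_range _ _ (hnod q t)] at h1
    exact congrFun (((hmono q (t + 1)).range_inj (hmono q t)).1 h1) i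
  set L : ℝ × ℝ → ℝ := fun z => lam i z.1 z.2 with hLdef
  have hL : ContDiff ℝ (⊤ : ℕ∞) L := hlam i
  have dL : ∀ z, DifferentiableAt ℝ L z := fun z => hL.differentiable (by simp) z
  set M1 := derivative M with hM1
  set R1 : Fin n → ℝ[X] := fun k => derivative (R k) with hR1
  set M2 := derivative M1 with hM2
  set R2 : Fin n → ℝ[X] := fun k => derivative (R1 k) with hR2
  have hP1 : ∀ z, derivative (auxPP M R (fun k => c k z)) = auxPP M1 R1 (fun k => c k z) :=
    fun z => auxPP_derivative _ _ _
  have hP2 : ∀ z, derivative (auxPP M1 R1 (fun k => c k z)) = auxPP M2 R2 (fun k => c k z) :=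
    fun z => auxPP_derivative _ _ _
  have hQ1 : ∀ d, derivative (auxPP 0 R d) = auxPP 0 R1 d := fun d => by
    rw [auxPP_derivative, derivative_zero]
  have hQ2 : ∀ d, derivative (auxPP 0 R1 d) = auxPP 0 R2 d := fun d => by
    rw [auxPP_derivative, derivative_zero]
  have hz0 : ∀ z, eval (L z) (auxPP M1 R1 (fun k => c k z)) = 0 := by
    intro z; rw [← hP1]; exact hroot' i z.1 z.2
  have dr : ∀ z v, fderiv ℝ (fun z => eval (L z) (auxPP M R (fun k => c k z))) z v =
      eval (L z) (auxPP 0 R (fun k => fderiv ℝ (c k) z v)) := by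
    intro z v
    rw [auxPP_hasFDerivAt M R c L z v (fun k => dc k z) (dL z), hP1, hz0]
    ring
  have d1 : ∀ z v, 0 = eval (L z) (auxPP 0 R1 (fun k => fderiv ℝ (c k) z v)) +
      eval (L z) (auxPP M2 R2 (fun k => c k z)) * fderiv ℝ L z v := by
    intro z v
    rw [← hP2, ← auxPP_hasFDerivAt M1 R1 c L z v (fun k => dc k z) (dL z)]
    simp [hz0]
  have d2 : ∀ z v, fderiv ℝ (fun z => eval (L z) (auxPP M2 R2 (fun k => c k z))) z v = _ :=
    fun z v => auxPP_hasFDerivAt M2 R2 c L z v (fun k => dc k z) (dL z)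
  have hAB : ∀ z, eval (L z) (auxPP M2 R2 (fun k => c k z)) ≠ 0 ∧
      eval (L z) (derivative (auxPP M2 R2 (fun k => c k z))) =
      eval (L z) (auxPP M2 R2 (fun k => c k z)) *
        (2 * ∑ j ∈ Finset.univ.erase i, (lam i z.1 z.2 - lam j z.1 z.2)⁻¹) := by
    intro z
    have := aux_nodal (fun j => lam j z.1 z.2) (hmono z.1 z.2) i _ (hnod z.1 z.2)
    rw [hP1, hP2] at this
    exact this
  obtain ⟨b, hb⟩ := aux_core (fun z => eval (L z) (auxPP M R (fun k => c k z))) L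
    (fun z => eval (L z) (auxPP M2 R2 (fun k => c k z)))
    (fun z => 2 * ∑ j ∈ Finset.univ.erase i, (lam i z.1 z.2 - lam j z.1 z.2)⁻¹)
    (auxPP_contDiff M R c L hu hL) hL (auxPP_contDiff M2 R2 c L hu hL)
    (by intro x y; simp only [hc1, hLdef, hl1]) (by intro x y; simp only [hc2, hLdef, hl2])
    (by intro x y; simp only [hLdef, hl1])
    (by intro x y; simp only [hc1, hLdef, hl1]) (by intro x y; simp only [hc2, hLdef, hl2])
    (by
      intro z
      obtain ⟨b, hb⟩ := hpoly z
      have h := congrArg (eval (L z)) hb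
      rw [hP1] at h
      simp only [eval_sub, eval_add, eval_mul, eval_X, eval_C, eval_zero, hz0] at h
      rw [dr, dr]
      linarith)
    (by
      intro z
      obtain ⟨b, hb⟩ := hpoly z
      rw [hP1] at hb
      have hb1 := congrArg derivative hb
      simp only [derivative_sub, derivative_add, derivative_mul, derivative_X, derivative_C,
        derivative_zero, zero_mul, zero_add, one_mul, hQ1, hP2] at hb1
      have hb2 := congrArg derivative hb1
      simp only [derivative_sub, derivative_add, derivative_mul, derivative_X, derivative_C,
        derivative_zero, zero_mul, zero_add, one_mul, hQ1, hQ2] at hb2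
      have h1 := congrArg (eval (L z)) hb1
      have h2 := congrArg (eval (L z)) hb2
      simp only [eval_sub, eval_add, eval_mul, eval_X, eval_C, eval_zero] at h1 h2
      obtain ⟨hA, hB⟩ := hAB z
      rw [d2, d2, dr]
      have q1 := d1 z (1, 0)
      have t1 := d1 z (0, 1)
      rw [hB] at h2 ⊢
      generalize eval (L z) (auxPP M2 R2 (fun k => c k z)) = A at *
      generalize (2 * ∑ j ∈ Finset.univ.erase i, (lam i z.1 z.2 - lam j z.1 z.2)⁻¹) = S at *
      generalize eval (L z) (auxPP 0 R1 (fun k => fderiv ℝ (c k) z (1, 0))) = Q1 at *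
      generalize eval (L z) (auxPP 0 R1 (fun k => fderiv ℝ (c k) z (0, 1))) = T1 at *
      generalize eval (L z) (auxPP 0 R2 (fun k => fderiv ℝ (c k) z (1, 0))) = Q2 at *
      generalize eval (L z) (auxPP 0 R2 (fun k => fderiv ℝ (c k) z (0, 1))) = T2 at *
      linear_combination h2 - S * h1 + (2 - S * L z) * q1 - S * t1)
    σ (fun z => hσ z.1 z.2)
  exact ⟨b, fun q t => by rw [hFe]; exact hb (q, t)⟩

end AuxRI


/-- for a globally strictly hyperbolic periodic solution, the
Riemann invariants of the minimal and maximal eigenvalues are constant. -/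
theorem extreme_riemann_invariants_constant
    (n : ℕ) (hn : 2 ≤ n)
    (u : Fin n → ℝ → ℝ → ℝ)
    (hu : ∀ k, ContDiff ℝ (⊤ : ℕ∞) (fun z : ℝ × ℝ => u k z.1 z.2))
    (huq : ∀ k t, Function.Periodic (fun q => u k q t) 1)
    (hut : ∀ k q, Function.Periodic (fun t => u k q t) 1)
    (F : ℝ → ℝ → ℝ → ℝ)
    (hF : ∀ p q t, F p q t =
      p ^ (n + 1) / ((n : ℝ) + 1) + ∑ k : Fin n, u k q t * p ^ (n - 1 - (k : ℕ)))
    (hcons : ∀ p q t,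
      deriv (fun s => F p q s) t + p * deriv (fun x => F p x t) q
        - deriv (fun x => u ⟨0, by omega⟩ x t) q * deriv (fun y => F y q t) p = 0)
    (lam : Fin n → ℝ → ℝ → ℝ)
    (hlam : ∀ i, ContDiff ℝ (⊤ : ℕ∞) (fun z : ℝ × ℝ => lam i z.1 z.2))
    (hroot : ∀ i q t, deriv (fun p => F p q t) (lam i q t) = 0)
    (horder : ∀ q t, ∀ i j : Fin n, i < j → lam i q t < lam j q t) :
    (∃ c : ℝ, ∀ q t, F (lam ⟨0, by omega⟩ q t) q t = c) ∧
    (∃ c : ℝ, ∀ q t, F (lam ⟨n - 1, by omega⟩ q t) q t = c) := by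
  have hsum : ∀ (i j : Fin n), j ≠ i → (Finset.univ.erase i).Nonempty := fun i j h =>
    ⟨j, Finset.mem_erase.2 ⟨h, Finset.mem_univ _⟩⟩
  constructor
  · refine AuxRI.aux_main n hn _ u hu huq hut F hF hcons lam hlam hroot horder _ (-1) ?_
    intro q t
    have h : 0 < ∑ j ∈ Finset.univ.erase (⟨0, by omega⟩ : Fin n),
        -(lam ⟨0, by omega⟩ q t - lam j q t)⁻¹ := by
      apply Finset.sum_pos
      · intro j hj
        have hj' := Finset.ne_of_mem_erase hj
        have h0 : (⟨0, by omega⟩ : Fin n) < j := by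
          rw [Fin.lt_def]
          have : (j : ℕ) ≠ 0 := fun h => hj' (Fin.ext h)
          exact Nat.pos_of_ne_zero this
        have := horder q t _ _ h0
        rw [neg_pos, inv_lt_zero]
        linarith
      · exact hsum _ ⟨1, by omega⟩ (by simp)
    rw [Finset.sum_neg_distrib] at h
    linarith
  · refine AuxRI.aux_main n hn _ u hu huq hut F hF hcons lam hlam hroot horder _ 1 ?_
    intro q t
    have h : 0 < ∑ j ∈ Finset.univ.erase (⟨n - 1, by omega⟩ : Fin n),
        (lam ⟨n - 1, by omega⟩ q t - lam j q t)⁻¹ := by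
      apply Finset.sum_pos
      · intro j hj
        have hj' := Finset.ne_of_mem_erase hj
        have h0 : j < (⟨n - 1, by omega⟩ : Fin n) := by
          rw [Fin.lt_def]
          have : (j : ℕ) ≠ n - 1 := fun h => hj' (Fin.ext h)
          have := j.2
          simp only
          omega
        have := horder q t _ _ h0
        rw [inv_pos]
        linarith
      · refine hsum _ ⟨0, by omega⟩ ?_
        intro h
        have := congrArg Fin.val h
        simp only at this
        omega
    linarith
end

section
/- Let u₁, u₂, u₃ be a smooth periodic solution of the quasi-linear system. Then the Riemann invariants r₁ and r₃, corresponding to the minimal and maximal characteristic roots, are constant on every connected component of the strictly hyperbolic region Ω_h. -/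
section Bn
open Set Filter Topology MeasureTheory

lemma bn_torus (P Q : ℝ × ℝ → ℝ) (hP : ContDiff ℝ 1 P) (hQ : ContDiff ℝ 1 Q)
    (hPq : ∀ z, P (z + (1, 0)) = P z) (hQt : ∀ z, Q (z + (0, 1)) = Q z)
    (hS : ∀ z, 0 ≤ fderiv ℝ P z (1, 0) + fderiv ℝ Q z (0, 1)) :
    ∀ z, fderiv ℝ P z (1, 0) + fderiv ℝ Q z (0, 1) = 0 := by
  intro z
  have hcont : Continuous (fun z => fderiv ℝ P z (1, 0) + fderiv ℝ Q z (0, 1)) :=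
    ((hP.continuous_fderiv one_ne_zero).clm_apply continuous_const).add
      ((hQ.continuous_fderiv one_ne_zero).clm_apply continuous_const)
  set a : ℝ × ℝ := (z.1 - 1/2, z.2 - 1/2) with ha
  set b : ℝ × ℝ := (z.1 + 1/2, z.2 + 1/2) with hb
  have hle : a ≤ b := by
    constructor <;> simp [ha, hb] <;> linarith
  have hint : IntegrableOn (fun z => fderiv ℝ P z (1, 0) + fderiv ℝ Q z (0, 1)) (Icc a b) :=
    hcont.continuousOn.integrableOn_compact isCompact_Icc
  have key := integral_divergence_prod_Icc_of_hasFDerivAt_of_le P Q (fderiv ℝ P) (fderiv ℝ Q) a b hle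
    hP.continuous.continuousOn hQ.continuous.continuousOn
    (fun x _ => (hP.differentiable one_ne_zero x).hasFDerivAt)
    (fun x _ => (hQ.differentiable one_ne_zero x).hasFDerivAt) hint
  have e1 : ∀ x, Q (x, b.2) = Q (x, a.2) := by
    intro x
    rw [← hQt (x, a.2)]
    congr 1
    ext <;> simp [ha, hb]
    ring
  have e2 : ∀ x, P (b.1, x) = P (a.1, x) := by
    intro x
    rw [← hPq (a.1, x)]
    congr 1
    ext <;> simp [ha, hb]
    ring
  simp only [e1, e2] at key
  have key0 : ∫ x in Icc a b, fderiv ℝ P x (1, 0) + fderiv ℝ Q x (0, 1) = 0 := by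
    rw [key]; ring
  rw [setIntegral_eq_zero_iff_of_nonneg_ae (Eventually.of_forall hS) hint] at key0
  have hsub : Ioo a.1 b.1 ×ˢ Ioo a.2 b.2 ⊆ Icc a b := by
    rintro ⟨x, y⟩ ⟨h1, h2⟩
    exact ⟨⟨h1.1.le, h2.1.le⟩, ⟨h1.2.le, h2.2.le⟩⟩
  have := Measure.eqOn_open_of_ae_eq (ae_restrict_of_ae_restrict_of_subset hsub key0)
    (isOpen_Ioo.prod isOpen_Ioo) hcont.continuousOn continuousOn_const
  exact this (x := z) (by constructor <;> constructor <;> simp [ha, hb])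

lemma bn_h_deriv (ε x : ℝ) :
    HasDerivAt (fun x : ℝ => (max (x - ε) 0) ^ 2) (2 * max (x - ε) 0) x := by
  rcases lt_trichotomy x ε with h | h | h
  · rw [max_eq_right (by linarith)]
    have : (fun x : ℝ => (max (x - ε) 0) ^ 2) =ᶠ[𝓝 x] fun _ => 0 := by
      filter_upwards [Iio_mem_nhds h] with y hy
      rw [max_eq_right (by have : y < ε := hy; linarith)]; simp
    simpa using (hasDerivAt_const x (0:ℝ)).congr_of_eventuallyEq this
  · subst h
    simp only [sub_self, max_self, mul_zero]
    rw [hasDerivAt_iff_isLittleO_nhds_zero]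
    have : (fun h : ℝ => h ^ 2) =o[𝓝 0] (fun h : ℝ => h) := by
      simpa using Asymptotics.isLittleO_pow_id (𝕜 := ℝ) (n := 2) (by norm_num)
    refine Asymptotics.IsBigO.trans_isLittleO (Asymptotics.IsBigO.of_bound 1 ?_) this
    filter_upwards with y
    simp only [add_sub_cancel_left, sub_self, max_self, smul_zero, sub_zero, one_mul]
    simp only [ne_eq, OfNat.ofNat_ne_zero, not_false_eq_true, zero_pow, sub_zero, norm_pow]
    have : ‖max y 0‖ ≤ ‖y‖ := by
      rcases le_total y 0 with h | h
      · rw [max_eq_right h]; simp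
      · rw [max_eq_left h]
    gcongr
  · rw [max_eq_left (by linarith)]
    have : (fun x : ℝ => (max (x - ε) 0) ^ 2) =ᶠ[𝓝 x] fun x => (x - ε) ^ 2 := by
      filter_upwards [Ioi_mem_nhds h] with y hy
      rw [max_eq_left (by have : ε < y := hy; linarith)]
    have h2 : HasDerivAt (fun x => (x - ε) ^ 2) (2 * (x - ε)) x := by
      simpa using ((hasDerivAt_id x).sub_const ε).fun_pow 2
    exact h2.congr_of_eventuallyEq this

lemma bn_h_contDiff (ε : ℝ) : ContDiff ℝ 1 (fun x : ℝ => (max (x - ε) 0) ^ 2) := by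
  rw [contDiff_one_iff_deriv]
  refine ⟨fun x => (bn_h_deriv ε x).differentiableAt, ?_⟩
  have : deriv (fun x : ℝ => (max (x - ε) 0) ^ 2) = fun x => 2 * max (x - ε) 0 :=
    funext fun x => (bn_h_deriv ε x).deriv
  rw [this]; fun_prop

lemma bn_symm (a : ℝ × ℝ → ℝ) (z : ℝ × ℝ) (h : ContDiffAt ℝ 2 a z) (v w : ℝ × ℝ) :
    fderiv ℝ (fun x => fderiv ℝ a x v) z w = fderiv ℝ (fun x => fderiv ℝ a x w) z v := by
  have hs : IsSymmSndFDerivAt ℝ a z := h.isSymmSndFDerivAt (by simp)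
  have hd : DifferentiableAt ℝ (fderiv ℝ a) z :=
    (h.fderiv_right (m := 1) (by norm_num)).differentiableAt one_ne_zero
  have e : ∀ v w, fderiv ℝ (fun x => fderiv ℝ a x v) z w = fderiv ℝ (fderiv ℝ a) z w v := by
    intro v w
    rw [fderiv_clm_apply hd (differentiableAt_const v)]
    simp
  rw [e, e]; exact hs.eq _ _

lemma bn_dir_contDiffAt (a : ℝ × ℝ → ℝ) (z : ℝ × ℝ) (h : ContDiffAt ℝ 2 a z) (v : ℝ × ℝ) :
    ContDiffAt ℝ 1 (fun x => fderiv ℝ a x v) z :=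
  (h.fderiv_right (m := 1) (by norm_num)).clm_apply contDiffAt_const

lemma bn_per (a : ℝ × ℝ → ℝ) (e : ℝ × ℝ) (h : ∀ z, a (z + e) = a z) (z : ℝ × ℝ) :
    fderiv ℝ a (z + e) = fderiv ℝ a z := by
  rw [← fderiv_comp_add_right]; simp only [h]

lemma bn_locdiv (V : Set (ℝ × ℝ)) (hV : IsOpen V) (y a : ℝ × ℝ → ℝ)
    (hy : ∀ z ∈ V, ContDiffAt ℝ 1 y z) (ha : ∀ z ∈ V, ContDiffAt ℝ 2 a z)
    (hV1 : ∀ z, z + (1, 0) ∈ V ↔ z ∈ V) (hV2 : ∀ z, z + (0, 1) ∈ V ↔ z ∈ V)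
    (hy1 : ∀ z, y (z + (1, 0)) = y z) (hy2 : ∀ z, y (z + (0, 1)) = y z)
    (ha1 : ∀ z, a (z + (1, 0)) = a z) (ha2 : ∀ z, a (z + (0, 1)) = a z)
    (hcl : ∀ ε > 0, IsClosed {z | z ∈ V ∧ ε ≤ y z})
    (hσ : ∀ z ∈ V, 0 ≤ fderiv ℝ y z (0, 1) * fderiv ℝ a z (1, 0)
      - fderiv ℝ y z (1, 0) * fderiv ℝ a z (0, 1)) :
    ∀ z ∈ V, 0 < y z → fderiv ℝ y z (0, 1) * fderiv ℝ a z (1, 0)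
      - fderiv ℝ y z (1, 0) * fderiv ℝ a z (0, 1) = 0 := by
  classical
  intro z₀ hz₀ hyz
  set ε := y z₀ / 2 with hε
  have hε0 : 0 < ε := by positivity
  set h : ℝ → ℝ := fun x => (max (x - ε) 0) ^ 2 with hh
  set P : ℝ × ℝ → ℝ := fun z => if z ∈ V then -(h (y z) * fderiv ℝ a z (0, 1)) else 0 with hPdef
  set Q : ℝ × ℝ → ℝ := fun z => if z ∈ V then h (y z) * fderiv ℝ a z (1, 0) else 0 with hQdef
  have hout : ∀ z ∉ V, P =ᶠ[𝓝 z] (fun _ => 0) ∧ Q =ᶠ[𝓝 z] (fun _ => 0) := by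
    intro z hz
    have hopen := (hcl ε hε0).isOpen_compl.mem_nhds (x := z) (by simp [hz])
    have hyy : ∀ x, x ∈ {z | z ∈ V ∧ ε ≤ y z}ᶜ → x ∈ V → h (y x) = 0 := by
      intro x hx hxV
      have : y x < ε := by
        by_contra hcon
        exact hx ⟨hxV, not_lt.mp hcon⟩
      simp only [hh]
      rw [max_eq_right (by linarith)]; simp
    constructor
    · filter_upwards [hopen] with x hx
      by_cases hxV : x ∈ V
      · simp [hPdef, hyy x hx hxV]
      · simp [hPdef, hxV]
    · filter_upwards [hopen] with x hx
      by_cases hxV : x ∈ V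
      · simp [hQdef, hyy x hx hxV]
      · simp [hQdef, hxV]
  have hinP : ∀ z ∈ V, P =ᶠ[𝓝 z] fun z => -(h (y z) * fderiv ℝ a z (0, 1)) := by
    intro z hz
    filter_upwards [hV.mem_nhds hz] with x hx
    simp [hPdef, hx]
  have hinQ : ∀ z ∈ V, Q =ᶠ[𝓝 z] fun z => h (y z) * fderiv ℝ a z (1, 0) := by
    intro z hz
    filter_upwards [hV.mem_nhds hz] with x hx
    simp [hQdef, hx]
  have hhy : ∀ z ∈ V, ContDiffAt ℝ 1 (fun z => h (y z)) z := fun z hz =>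
    (bn_h_contDiff ε).contDiffAt.comp z (hy z hz)
  have hP : ContDiff ℝ 1 P := by
    rw [contDiff_iff_contDiffAt]
    intro z
    by_cases hz : z ∈ V
    · exact (((hhy z hz).mul (bn_dir_contDiffAt a z (ha z hz) _)).neg).congr_of_eventuallyEq
        (hinP z hz)
    · exact contDiffAt_const.congr_of_eventuallyEq (hout z hz).1
  have hQ : ContDiff ℝ 1 Q := by
    rw [contDiff_iff_contDiffAt]
    intro z
    by_cases hz : z ∈ V
    · exact ((hhy z hz).mul (bn_dir_contDiffAt a z (ha z hz) _)).congr_of_eventuallyEq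
        (hinQ z hz)
    · exact contDiffAt_const.congr_of_eventuallyEq (hout z hz).2
  have hdiv : ∀ z ∈ V, fderiv ℝ P z (1, 0) + fderiv ℝ Q z (0, 1) =
      2 * max (y z - ε) 0 * (fderiv ℝ y z (0, 1) * fderiv ℝ a z (1, 0)
      - fderiv ℝ y z (1, 0) * fderiv ℝ a z (0, 1)) := by
    intro z hz
    rw [(hinP z hz).fderiv_eq, (hinQ z hz).fderiv_eq]
    have d1 : DifferentiableAt ℝ (fun z => h (y z)) z := (hhy z hz).differentiableAt one_ne_zero
    have d2 := fun v => (bn_dir_contDiffAt a z (ha z hz) v).differentiableAt one_ne_zero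
    have d3 : fderiv ℝ (fun z => h (y z)) z = (2 * max (y z - ε) 0) • fderiv ℝ y z :=
      ((bn_h_deriv ε (y z)).comp_hasFDerivAt z
        ((hy z hz).differentiableAt one_ne_zero).hasFDerivAt).fderiv
    rw [fderiv_fun_neg, fderiv_fun_mul d1 (d2 _), fderiv_fun_mul d1 (d2 _), d3]
    have := bn_symm a z (ha z hz) (1, 0) (0, 1)
    simp [this]
    ring
  have := bn_torus P Q hP hQ ?_ ?_ ?_ z₀
  · rw [hdiv z₀ hz₀] at this
    have hpos : 0 < max (y z₀ - ε) 0 := lt_max_of_lt_left (by rw [hε]; linarith)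
    rcases mul_eq_zero.mp this with h' | h'
    · linarith
    · exact h'
  · intro z
    simp only [hPdef, hV1, hy1, bn_per a _ ha1]
  · intro z
    simp only [hQdef, hV2, hy2, bn_per a _ ha2]
  · intro z
    by_cases hz : z ∈ V
    · rw [hdiv z hz]
      exact mul_nonneg (mul_nonneg zero_le_two (le_max_right _ _)) (hσ z hz)
    · rw [(hout z hz).1.fderiv_eq, (hout z hz).2.fderiv_eq]; simp

lemma bn_proj (C : Set ((ℝ × ℝ) × ℝ)) (hC : IsClosed C) (B : ℝ × ℝ → ℝ) (hB : Continuous B)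
    (hb : ∀ z l, (z, l) ∈ C → |l| ≤ B z) : IsClosed {z | ∃ l, (z, l) ∈ C} := by
  rw [← isOpen_compl_iff, isOpen_iff_mem_nhds]
  intro z hz
  have hz' : ∀ l, (z, l) ∉ C := by simpa using hz
  have h1 : ∀ᶠ x in 𝓝 z, ∀ l ∈ Icc (-(B z + 1)) (B z + 1), (x, l) ∉ C := by
    apply isCompact_Icc.eventually_forall_of_forall_eventually
    intro l _
    exact hC.isOpen_compl.mem_nhds (hz' l)
  have h2 : ∀ᶠ x in 𝓝 z, B x < B z + 1 :=
    hB.continuousAt.eventually_lt continuousAt_const (by linarith)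
  filter_upwards [h1, h2] with x hx1 hx2
  rintro ⟨l, hl⟩
  have := hb x l hl
  exact hx1 l (abs_le.mp (by linarith)) hl

lemma bn_root_bound (x y l : ℝ) (h : l ^ 3 + 2 * x * l + y = 0) : |l| ≤ 1 + 2 * |x| + |y| := by
  by_contra hcon
  push Not at hcon
  have hx := abs_nonneg x
  have hy := abs_nonneg y
  have h3 : |l| ^ 3 ≤ 2 * |x| * |l| + |y| := by
    have : l ^ 3 = -(2 * x * l) + -y := by linarith
    calc |l| ^ 3 = |l ^ 3| := (abs_pow _ _).symm
      _ = |-(2 * x * l) + -y| := by rw [this]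
      _ ≤ |-(2 * x * l)| + |-y| := abs_add_le _ _
      _ = _ := by simp [abs_mul]
  have hl1 : 1 < |l| := by linarith
  have : |l| * (2 * |x| + |y|) < |l| * (|l| * |l|) := by
    apply mul_lt_mul_of_pos_left _ (by linarith)
    nlinarith
  nlinarith

def BnRoot (s x y l : ℝ) : Prop := 0 < s * l ∧ l ^ 3 + 2 * x * l + y = 0 ∧ 0 < 3 * l ^ 2 + 2 * x

open Classical in
noncomputable def bnL (s x y : ℝ) : ℝ := if h : ∃ l, BnRoot s x y l then h.choose else 0

lemma bn_unique (s x y l m : ℝ) (hl : BnRoot s x y l) (hm : BnRoot s x y m) : l = m := by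
  obtain ⟨a1, a2, a3⟩ := hl
  obtain ⟨b1, b2, b3⟩ := hm
  by_contra hne
  have hq : l ^ 2 + l * m + m ^ 2 + 2 * x = 0 := by
    have : (l - m) * (l ^ 2 + l * m + m ^ 2 + 2 * x) = 0 := by linear_combination a2 - b2
    exact (mul_eq_zero.mp this).resolve_left (sub_ne_zero.mpr hne)
  have c1 : 0 < (2 * l + m) * (l - m) := by nlinarith
  have c2 : 0 < (2 * m + l) * (m - l) := by nlinarith
  have c3 : 0 < l * m := by
    have : 0 < (s * l) * (s * m) := mul_pos a1 b1
    have h2 : 0 < s ^ 2 * (l * m) := by linarith [this, show (s * l) * (s * m) = s ^ 2 * (l * m) by ring]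
    exact pos_of_mul_pos_right h2 (sq_nonneg s)
  have c4 := mul_pos c1 c2
  have c5 : 0 ≤ (2 * l + m) * (2 * m + l) := by nlinarith [sq_nonneg (l), sq_nonneg m]
  nlinarith [mul_nonneg c5 (sq_nonneg (l - m))]

lemma bn_eq (s x y l : ℝ) (hl : BnRoot s x y l) : bnL s x y = l := by
  have h : ∃ l, BnRoot s x y l := ⟨l, hl⟩
  unfold bnL
  rw [dif_pos h]
  exact bn_unique s x y _ _ h.choose_spec hl

lemma bn_smooth (s : ℝ) (w : ℝ × ℝ) (l : ℝ) (hl : BnRoot s w.1 w.2 l) :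
    ContDiffAt ℝ 2 (fun w : ℝ × ℝ => bnL s w.1 w.2) w ∧
      ∀ᶠ x in 𝓝 w, ∃ l, BnRoot s x.1 x.2 l := by
  obtain ⟨a1, a2, a3⟩ := id hl
  set f : (ℝ × ℝ) × ℝ → ℝ := fun p => p.2 ^ 3 + 2 * p.1.1 * p.2 + p.1.2 with hf
  have cdf : ContDiffAt ℝ 2 f (w, l) := by
    apply ContDiff.contDiffAt; fun_prop
  have hinv : (fderiv ℝ f (w, l) ∘L .inr ℝ (ℝ × ℝ) ℝ).IsInvertible := by
    have hd : HasDerivAt (fun t : ℝ => f (w, t)) (3 * l ^ 2 + 2 * w.1) l := by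
      have := ((hasDerivAt_pow 3 l).add ((hasDerivAt_id l).const_mul (2 * w.1))).add_const w.2
      convert! this using 1
      simp
    have hd2 : HasDerivAt (fun t : ℝ => f (w, t)) (fderiv ℝ f (w, l) (0, 1)) l := by
      have h1 : HasFDerivAt f (fderiv ℝ f (w, l)) (w, l) :=
        (cdf.differentiableAt two_ne_zero).hasFDerivAt
      have h2 : HasDerivAt (fun t : ℝ => (w, t)) ((0 : ℝ × ℝ), (1 : ℝ)) l :=
        (hasDerivAt_const l w).prodMk (hasDerivAt_id l)
      exact h1.comp_hasDerivAt l h2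
    have he := hd2.unique hd
    refine ⟨ContinuousLinearEquiv.unitsEquivAut ℝ (Units.mk0 (3 * l ^ 2 + 2 * w.1) a3.ne'), ?_⟩
    ext
    simp [he]
  set φ := cdf.implicitFunction two_ne_zero hinv with hφ
  have h1 : φ w = l := cdf.implicitFunction_apply_self two_ne_zero hinv
  have h2 : ContDiffAt ℝ 2 φ w := cdf.contDiffAt_implicitFunction two_ne_zero hinv
  have h3 : ∀ᶠ x in 𝓝 w, f (x, φ x) = f (w, l) :=
    cdf.eventually_apply_implicitFunction two_ne_zero hinv
  have hc := h2.continuousAt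
  have h4 : ∀ᶠ x in 𝓝 w, 0 < s * φ x := by
    have : ContinuousAt (fun x => s * φ x) w := by fun_prop
    exact continuousAt_const.eventually_lt this (by rw [h1]; exact a1)
  have h5 : ∀ᶠ x in 𝓝 w, 0 < 3 * φ x ^ 2 + 2 * x.1 := by
    have : ContinuousAt (fun x : ℝ × ℝ => 3 * φ x ^ 2 + 2 * x.1) w := by fun_prop
    exact continuousAt_const.eventually_lt this (by rw [h1]; exact a3)
  have h6 : ∀ᶠ x in 𝓝 w, BnRoot s x.1 x.2 (φ x) := by
    filter_upwards [h3, h4, h5] with x k3 k4 k5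
    refine ⟨k4, ?_, k5⟩
    simp only [hf] at k3
    rw [k3, a2]
  refine ⟨h2.congr_of_eventuallyEq ?_, h6.mono fun x hx => ⟨_, hx⟩⟩
  filter_upwards [h6] with x hx
  exact bn_eq _ _ _ _ hx

structure BnSol (U1 U2 U3 : ℝ × ℝ → ℝ) : Prop where
  c1 : ContDiff ℝ 2 U1
  c2 : ContDiff ℝ 2 U2
  c3 : ContDiff ℝ 2 U3
  q1 : ∀ z, U1 (z + (1, 0)) = U1 z
  q2 : ∀ z, U2 (z + (1, 0)) = U2 z
  q3 : ∀ z, U3 (z + (1, 0)) = U3 z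
  t1 : ∀ z, U1 (z + (0, 1)) = U1 z
  t2 : ∀ z, U2 (z + (0, 1)) = U2 z
  t3 : ∀ z, U3 (z + (0, 1)) = U3 z
  s1 : ∀ z, fderiv ℝ U1 z (0, 1) = - fderiv ℝ U2 z (1, 0)
  s2 : ∀ z, fderiv ℝ U2 z (0, 1) = - fderiv ℝ U3 z (1, 0) + 2 * U1 z * fderiv ℝ U1 z (1, 0)
  s3 : ∀ z, fderiv ℝ U3 z (0, 1) = U2 z * fderiv ℝ U1 z (1, 0)

noncomputable def bnl (U1 U2 : ℝ × ℝ → ℝ) (s : ℝ) (z : ℝ × ℝ) : ℝ := bnL s (U1 z) (U2 z)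

def bnV (U1 U2 : ℝ × ℝ → ℝ) (s : ℝ) : Set (ℝ × ℝ) := {z | ∃ l, BnRoot s (U1 z) (U2 z) l}

lemma bn_mem {U1 U2 : ℝ × ℝ → ℝ} {s : ℝ} {z : ℝ × ℝ} (hz : z ∈ bnV U1 U2 s) :
    BnRoot s (U1 z) (U2 z) (bnl U1 U2 s z) := by
  obtain ⟨l, hl⟩ := hz
  unfold bnl
  rw [bn_eq _ _ _ _ hl]; exact hl

lemma bn_V_open {U1 U2 : ℝ × ℝ → ℝ} (c1 : ContDiff ℝ 2 U1) (c2 : ContDiff ℝ 2 U2) (s : ℝ) :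
    IsOpen (bnV U1 U2 s) := by
  rw [isOpen_iff_mem_nhds]
  rintro z ⟨l, hl⟩
  have h := (bn_smooth s (U1 z, U2 z) l hl).2
  have hc : ContinuousAt (fun z => (U1 z, U2 z)) z :=
    (c1.continuous.prodMk c2.continuous).continuousAt
  exact hc.eventually h

lemma bn_l_smooth {U1 U2 : ℝ × ℝ → ℝ} (c1 : ContDiff ℝ 2 U1) (c2 : ContDiff ℝ 2 U2) {s : ℝ}
    {z : ℝ × ℝ} (hz : z ∈ bnV U1 U2 s) : ContDiffAt ℝ 2 (bnl U1 U2 s) z := by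
  obtain ⟨l, hl⟩ := hz
  have h := (bn_smooth s (U1 z, U2 z) l hl).1
  exact h.comp z (c1.prodMk c2).contDiffAt

lemma bn_l_deriv {U1 U2 : ℝ × ℝ → ℝ} (c1 : ContDiff ℝ 2 U1) (c2 : ContDiff ℝ 2 U2) {s : ℝ}
    {z : ℝ × ℝ} (hz : z ∈ bnV U1 U2 s) (v : ℝ × ℝ) :
    (3 * bnl U1 U2 s z ^ 2 + 2 * U1 z) * fderiv ℝ (bnl U1 U2 s) z v +
      2 * bnl U1 U2 s z * fderiv ℝ U1 z v + fderiv ℝ U2 z v = 0 := by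
  have d0 : DifferentiableAt ℝ (bnl U1 U2 s) z := (bn_l_smooth c1 c2 hz).differentiableAt two_ne_zero
  have d1 : DifferentiableAt ℝ U1 z := c1.differentiable two_ne_zero z
  have d2 : DifferentiableAt ℝ U2 z := c2.differentiable two_ne_zero z
  have he : (fun z => bnl U1 U2 s z ^ 3 + 2 * U1 z * bnl U1 U2 s z + U2 z) =ᶠ[𝓝 z] fun _ => 0 := by
    filter_upwards [(bn_V_open c1 c2 s).mem_nhds hz] with x hx
    exact (bn_mem hx).2.1
  have := congrArg (fun L : (ℝ × ℝ) →L[ℝ] ℝ => L v) he.fderiv_eq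
  simp (disch := fun_prop) [fderiv_fun_add, fderiv_fun_mul, fderiv_fun_pow] at this
  linear_combination this

/-- potential in the hyperbolic case -/
noncomputable def bnr (U1 U2 U3 : ℝ × ℝ → ℝ) (s : ℝ) (z : ℝ × ℝ) : ℝ :=
  bnl U1 U2 s z ^ 4 / 4 + U1 z * bnl U1 U2 s z ^ 2 + U2 z * bnl U1 U2 s z + U3 z

lemma bn_r_deriv {U1 U2 U3 : ℝ × ℝ → ℝ} (H : BnSol U1 U2 U3) {s : ℝ}
    {z : ℝ × ℝ} (hz : z ∈ bnV U1 U2 s) (v : ℝ × ℝ) :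
    fderiv ℝ (bnr U1 U2 U3 s) z v = fderiv ℝ U1 z v * bnl U1 U2 s z ^ 2
      + fderiv ℝ U2 z v * bnl U1 U2 s z + fderiv ℝ U3 z v := by
  have d0 : DifferentiableAt ℝ (bnl U1 U2 s) z :=
    (bn_l_smooth H.c1 H.c2 hz).differentiableAt two_ne_zero
  have d1 : DifferentiableAt ℝ U1 z := H.c1.differentiable two_ne_zero z
  have d2 : DifferentiableAt ℝ U2 z := H.c2.differentiable two_ne_zero z
  have d3 : DifferentiableAt ℝ U3 z := H.c3.differentiable two_ne_zero z
  have hroot := (bn_mem hz).2.1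
  unfold bnr
  simp (disch := fun_prop) [fderiv_fun_add, fderiv_fun_mul, fderiv_fun_pow, div_eq_mul_inv]
  linear_combination (fderiv ℝ (bnl U1 U2 s) z v) * hroot

lemma bn_r_smooth {U1 U2 U3 : ℝ × ℝ → ℝ} (H : BnSol U1 U2 U3) {s : ℝ}
    {z : ℝ × ℝ} (hz : z ∈ bnV U1 U2 s) : ContDiffAt ℝ 2 (bnr U1 U2 U3 s) z := by
  have d0 := bn_l_smooth H.c1 H.c2 hz
  have d1 := H.c1.contDiffAt (x := z)
  have d2 := H.c2.contDiffAt (x := z)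
  have d3 := H.c3.contDiffAt (x := z)
  unfold bnr
  fun_prop

/-- elliptic quantities -/
noncomputable def bnm (U1 U2 : ℝ × ℝ → ℝ) (s : ℝ) (z : ℝ × ℝ) : ℝ :=
  2 * U1 z + 3 / 4 * bnl U1 U2 s z ^ 2

noncomputable def bna (U1 U2 U3 : ℝ × ℝ → ℝ) (s : ℝ) (z : ℝ × ℝ) : ℝ :=
  s * (bnl U1 U2 s z ^ 4 / 64 + U1 z * bnl U1 U2 s z ^ 2 / 4 - U2 z * bnl U1 U2 s z / 2 + U3 z
    - bnm U1 U2 s z ^ 2 / 4)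

noncomputable def bny (U1 U2 : ℝ × ℝ → ℝ) (s : ℝ) (z : ℝ × ℝ) : ℝ :=
  bnl U1 U2 s z ^ 2 * bnm U1 U2 s z ^ 3

lemma bn_a_deriv {U1 U2 U3 : ℝ × ℝ → ℝ} (H : BnSol U1 U2 U3) {s : ℝ}
    {z : ℝ × ℝ} (hz : z ∈ bnV U1 U2 s) (v : ℝ × ℝ) :
    fderiv ℝ (bna U1 U2 U3 s) z v =
      s * (fderiv ℝ U1 z v * (bnl U1 U2 s z ^ 2 / 4 - bnm U1 U2 s z)
      - fderiv ℝ U2 z v * bnl U1 U2 s z / 2 + fderiv ℝ U3 z v) := by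
  have d0 : DifferentiableAt ℝ (bnl U1 U2 s) z :=
    (bn_l_smooth H.c1 H.c2 hz).differentiableAt two_ne_zero
  have d1 : DifferentiableAt ℝ U1 z := H.c1.differentiable two_ne_zero z
  have d2 : DifferentiableAt ℝ U2 z := H.c2.differentiable two_ne_zero z
  have d3 : DifferentiableAt ℝ U3 z := H.c3.differentiable two_ne_zero z
  have hroot := (bn_mem hz).2.1
  unfold bna bnm
  simp (disch := fun_prop) [fderiv_fun_add, fderiv_fun_sub, fderiv_fun_mul, fderiv_fun_pow, div_eq_mul_inv]
  left
  linear_combination -(fderiv ℝ (bnl U1 U2 s) z v) / 2 * hroot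

lemma bn_y_deriv {U1 U2 U3 : ℝ × ℝ → ℝ} (H : BnSol U1 U2 U3) {s : ℝ}
    {z : ℝ × ℝ} (hz : z ∈ bnV U1 U2 s) (v : ℝ × ℝ) :
    fderiv ℝ (bny U1 U2 s) z v = 2 * bnl U1 U2 s z * bnm U1 U2 s z ^ 2 *
      (bnl U1 U2 s z * fderiv ℝ U1 z v - fderiv ℝ U2 z v) := by
  have d0 : DifferentiableAt ℝ (bnl U1 U2 s) z :=
    (bn_l_smooth H.c1 H.c2 hz).differentiableAt two_ne_zero
  have d1 : DifferentiableAt ℝ U1 z := H.c1.differentiable two_ne_zero z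
  have hl := bn_l_deriv H.c1 H.c2 hz v
  unfold bny bnm
  simp (disch := fun_prop) [fderiv_fun_add, fderiv_fun_mul, fderiv_fun_pow, div_eq_mul_inv]
  linear_combination 2 * bnl U1 U2 s z * (2 * U1 z + 3 / 4 * bnl U1 U2 s z ^ 2) ^ 2 * hl

def bnVe (U1 U2 : ℝ × ℝ → ℝ) (s : ℝ) : Set (ℝ × ℝ) := {z | z ∈ bnV U1 U2 s ∧ 0 < bnm U1 U2 s z}

lemma bn_l_per {U1 U2 U3 : ℝ × ℝ → ℝ} (H : BnSol U1 U2 U3) (s : ℝ) :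
    (∀ z, bnl U1 U2 s (z + (1, 0)) = bnl U1 U2 s z) ∧ (∀ z, bnl U1 U2 s (z + (0, 1)) = bnl U1 U2 s z) := by
  constructor <;> intro z <;> simp only [bnl, H.q1, H.q2, H.t1, H.t2]

lemma bn_V_per {U1 U2 U3 : ℝ × ℝ → ℝ} (H : BnSol U1 U2 U3) (s : ℝ) :
    (∀ z, z + (1, 0) ∈ bnV U1 U2 s ↔ z ∈ bnV U1 U2 s) ∧
      (∀ z, z + (0, 1) ∈ bnV U1 U2 s ↔ z ∈ bnV U1 U2 s) := by
  constructor <;> intro z <;> simp only [bnV, mem_ofPred_eq, H.q1, H.q2, H.t1, H.t2]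

lemma bn_Ve_open {U1 U2 : ℝ × ℝ → ℝ} (c1 : ContDiff ℝ 2 U1) (c2 : ContDiff ℝ 2 U2) (s : ℝ) :
    IsOpen (bnVe U1 U2 s) := by
  rw [isOpen_iff_mem_nhds]
  rintro z ⟨hz, hm⟩
  have hc : ContinuousAt (bnm U1 U2 s) z := by
    have h0 := (bn_l_smooth c1 c2 hz).continuousAt
    have h1 := c1.continuous.continuousAt (x := z)
    unfold bnm; fun_prop
  filter_upwards [(bn_V_open c1 c2 s).mem_nhds hz, continuousAt_const.eventually_lt hc hm] with x h1 h2
  exact ⟨h1, h2⟩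

lemma bn_Ve_of {U1 U2 : ℝ × ℝ → ℝ} {s : ℝ} {z : ℝ × ℝ} {l : ℝ} (h0 : 0 ≤ s * l)
    (hr : l ^ 3 + 2 * U1 z * l + U2 z = 0) (hm : 0 ≤ 2 * U1 z + 3 / 4 * l ^ 2)
    (hs : s ≠ 0) (hy : l ^ 2 * (2 * U1 z + 3 / 4 * l ^ 2) ^ 3 ≠ 0) :
    z ∈ bnVe U1 U2 s ∧ bnl U1 U2 s z = l := by
  have hl : l ≠ 0 := by rintro rfl; simp at hy
  have hm' : 0 < 2 * U1 z + 3 / 4 * l ^ 2 := by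
    rcases hm.lt_or_eq with h | h
    · exact h
    · rw [← h] at hy; simp at hy
  have h0' : 0 < s * l := lt_of_le_of_ne h0 (mul_ne_zero hs hl).symm
  have hR : BnRoot s (U1 z) (U2 z) l := ⟨h0', hr, by nlinarith [sq_nonneg l]⟩
  have he : bnl U1 U2 s z = l := bn_eq _ _ _ _ hR
  refine ⟨⟨⟨l, hR⟩, ?_⟩, he⟩
  unfold bnm; rw [he]; exact hm'

lemma bn_Ve_closed {U1 U2 : ℝ × ℝ → ℝ} (c1 : Continuous U1) (c2 : Continuous U2) {s : ℝ}
    (hs : s ≠ 0) (S : Set ℝ) (hS : IsClosed S) (hS0 : (0:ℝ) ∉ S) :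
    IsClosed {z | z ∈ bnVe U1 U2 s ∧ bny U1 U2 s z ∈ S} := by
  have := bn_proj {p : (ℝ × ℝ) × ℝ | 0 ≤ s * p.2 ∧ p.2 ^ 3 + 2 * U1 p.1 * p.2 + U2 p.1 = 0 ∧
      0 ≤ 2 * U1 p.1 + 3 / 4 * p.2 ^ 2 ∧ p.2 ^ 2 * (2 * U1 p.1 + 3 / 4 * p.2 ^ 2) ^ 3 ∈ S} ?_
      (fun z => 1 + 2 * |U1 z| + |U2 z|) (by fun_prop) ?_
  · convert this using 1
    ext z
    constructor
    · rintro ⟨⟨hz, hm⟩, hy⟩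
      have hR := bn_mem hz
      exact ⟨bnl U1 U2 s z, hR.1.le, hR.2.1, hm.le, hy⟩
    · rintro ⟨l, h1, h2, h3, h4⟩
      have h5 := bn_Ve_of h1 h2 h3 hs (fun h => hS0 (by simp only at h4; rwa [h] at h4))
      refine ⟨h5.1, ?_⟩
      unfold bny bnm; rw [h5.2]; exact h4
  · refine IsClosed.and ?_ (IsClosed.and ?_ (IsClosed.and ?_ ?_))
    · exact isClosed_le (by fun_prop) (by fun_prop)
    · exact isClosed_eq (by fun_prop) (by fun_prop)
    · exact isClosed_le (by fun_prop) (by fun_prop)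
    · exact hS.preimage (by fun_prop)
  · rintro z l ⟨-, h, -⟩
    exact bn_root_bound _ _ _ h

lemma bn_fderiv_zero (f : ℝ × ℝ → ℝ) (z : ℝ × ℝ) (h1 : fderiv ℝ f z (1, 0) = 0)
    (h2 : fderiv ℝ f z (0, 1) = 0) : fderiv ℝ f z = 0 := by
  ext <;> simp [h1, h2]

lemma bn_elliptic {U1 U2 U3 : ℝ × ℝ → ℝ} (H : BnSol U1 U2 U3) {s : ℝ} (hs : s ≠ 0)
    (z₁ : ℝ × ℝ) (hz₁ : z₁ ∉ bnVe U1 U2 s) (z₀ : ℝ × ℝ) : z₀ ∉ bnVe U1 U2 s := by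
  intro hz₀
  have hVo := bn_Ve_open H.c1 H.c2 s
  have hσ : ∀ z ∈ bnVe U1 U2 s, fderiv ℝ (bny U1 U2 s) z (0, 1) * fderiv ℝ (bna U1 U2 U3 s) z (1, 0)
      - fderiv ℝ (bny U1 U2 s) z (1, 0) * fderiv ℝ (bna U1 U2 U3 s) z (0, 1) =
      2 * (s * bnl U1 U2 s z) * bnm U1 U2 s z ^ 2 *
      ((fderiv ℝ U1 z (1, 0) * (bnl U1 U2 s z ^ 2 / 4 - bnm U1 U2 s z)
      - fderiv ℝ U2 z (1, 0) * bnl U1 U2 s z / 2 + fderiv ℝ U3 z (1, 0)) ^ 2 +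
      bnm U1 U2 s z * (- bnl U1 U2 s z * fderiv ℝ U1 z (1, 0) + fderiv ℝ U2 z (1, 0)) ^ 2) := by
    intro z hz
    have hroot := (bn_mem hz.1).2.1
    have hu2 : U2 z = - bnl U1 U2 s z ^ 3 - 2 * U1 z * bnl U1 U2 s z := by linarith
    simp only [bn_y_deriv H hz.1, bn_a_deriv H hz.1, H.s1, H.s2, H.s3, hu2]
    unfold bnm
    ring
  have h0 := bn_locdiv (bnVe U1 U2 s) hVo (bny U1 U2 s) (bna U1 U2 U3 s) ?_ ?_ ?_ ?_ ?_ ?_ ?_ ?_ ?_ ?_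
  · have hder : ∀ z ∈ bnVe U1 U2 s, fderiv ℝ (bny U1 U2 s) z = 0 := by
      intro z hz
      have hR := bn_mem hz.1
      have hl : bnl U1 U2 s z ≠ 0 := by
        intro h; have := hR.1; rw [h] at this; simp at this
      have hm := hz.2
      have := h0 z hz (by unfold bny; positivity)
      rw [hσ z hz] at this
      have hne : 2 * (s * bnl U1 U2 s z) * bnm U1 U2 s z ^ 2 ≠ 0 := by
        have := hR.1; positivity
      have hsum := (mul_eq_zero.mp this).resolve_left hne
      rw [add_eq_zero_iff_of_nonneg (sq_nonneg _) (mul_nonneg hm.le (sq_nonneg _))] at hsum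
      obtain ⟨hA, hB⟩ := hsum
      have hA := pow_eq_zero_iff (two_ne_zero) |>.mp hA
      have hB := pow_eq_zero_iff (two_ne_zero) |>.mp ((mul_eq_zero.mp hB).resolve_left hm.ne')
      apply bn_fderiv_zero
      · rw [bn_y_deriv H hz.1]
        rw [mul_eq_zero]; right; linarith
      · rw [bn_y_deriv H hz.1, H.s1, H.s2]
        rw [mul_eq_zero]; right
        unfold bnm at hA
        linear_combination hA - bnl U1 U2 s z / 2 * hB
    set c := bny U1 U2 s z₀ with hc
    have hc0 : 0 < c := by
      have hR := bn_mem hz₀.1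
      have hl : bnl U1 U2 s z₀ ≠ 0 := by
        intro h; have := hR.1; rw [h] at this; simp at this
      have hm := hz₀.2
      rw [hc]; unfold bny; positivity
    have hdiff : DifferentiableOn ℝ (bny U1 U2 s) (bnVe U1 U2 s) := by
      intro z hz
      have d0 : DifferentiableAt ℝ (bnl U1 U2 s) z :=
        (bn_l_smooth H.c1 H.c2 hz.1).differentiableAt two_ne_zero
      have d1 : DifferentiableAt ℝ U1 z := H.c1.differentiable two_ne_zero z
      apply DifferentiableAt.differentiableWithinAt
      unfold bny bnm; fun_prop
    have hopen := hVo.isOpen_inter_preimage_of_fderiv_eq_zero hdiff (fun z hz => hder z hz) {c}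
    have hclosed := bn_Ve_closed H.c1.continuous H.c2.continuous hs {c} isClosed_singleton
      (by simpa using hc0.ne)
    have huniv := IsClopen.eq_univ (s := {z | z ∈ bnVe U1 U2 s ∧ bny U1 U2 s z ∈ ({c} : Set ℝ)})
      ⟨hclosed, hopen⟩ ⟨z₀, hz₀, by simp [hc]⟩
    have : z₁ ∈ {z | z ∈ bnVe U1 U2 s ∧ bny U1 U2 s z ∈ ({c} : Set ℝ)} := by rw [huniv]; trivial
    exact hz₁ this.1
  · intro z hz
    have d0 := (bn_l_smooth H.c1 H.c2 hz.1).of_le one_le_two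
    have d1 := H.c1.contDiffAt (x := z) |>.of_le one_le_two
    unfold bny bnm; fun_prop
  · intro z hz
    have d0 := bn_l_smooth H.c1 H.c2 hz.1
    have d1 := H.c1.contDiffAt (x := z)
    have d2 := H.c2.contDiffAt (x := z)
    have d3 := H.c3.contDiffAt (x := z)
    unfold bna bnm; fun_prop
  · intro z
    simp only [bnVe, mem_ofPred_eq, (bn_V_per H s).1, bnm, (bn_l_per H s).1, H.q1]
  · intro z
    simp only [bnVe, mem_ofPred_eq, (bn_V_per H s).2, bnm, (bn_l_per H s).2, H.t1]
  · intro z; simp only [bny, bnm, (bn_l_per H s).1, H.q1]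
  · intro z; simp only [bny, bnm, (bn_l_per H s).2, H.t1]
  · intro z; simp only [bna, bnm, (bn_l_per H s).1, H.q1, H.q2, H.q3]
  · intro z; simp only [bna, bnm, (bn_l_per H s).2, H.t1, H.t2, H.t3]
  · intro ε hε
    exact bn_Ve_closed H.c1.continuous H.c2.continuous hs (Ici ε) isClosed_Ici (by simpa using hε)
  · intro z hz
    rw [hσ z hz]
    have := (bn_mem hz.1).1
    have hm := hz.2
    positivity

/-- hyperbolic case -/
noncomputable def bnE (U1 U2 U3 : ℝ × ℝ → ℝ) (s : ℝ) (z : ℝ × ℝ) : ℝ :=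
  fderiv ℝ U1 z (1, 0) * bnl U1 U2 s z ^ 2 + fderiv ℝ U2 z (1, 0) * bnl U1 U2 s z
    + fderiv ℝ U3 z (1, 0)

noncomputable def bnD (U1 U2 : ℝ × ℝ → ℝ) (s : ℝ) (z : ℝ × ℝ) : ℝ :=
  3 * bnl U1 U2 s z ^ 2 + 2 * U1 z

lemma bn_hyper {U1 U2 U3 : ℝ × ℝ → ℝ} (H : BnSol U1 U2 U3) {s : ℝ} (hs : s ≠ 0)
    (hel : ∀ z, z ∉ bnVe U1 U2 s) (z₀ : ℝ × ℝ) (hz₀ : z₀ ∈ bnV U1 U2 s) :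
    fderiv ℝ (bnr U1 U2 U3 s) z₀ = 0 := by
  have hVo := bn_V_open H.c1 H.c2 s
  have hneg : ∀ z ∈ bnV U1 U2 s, 2 * U1 z + 3 / 4 * bnl U1 U2 s z ^ 2 ≤ 0 := by
    intro z hz
    by_contra h
    exact hel z ⟨hz, not_le.mp h⟩
  have hrq : ∀ z ∈ bnV U1 U2 s, fderiv ℝ (bnr U1 U2 U3 s) z (1, 0) = bnE U1 U2 U3 s z :=
    fun z hz => bn_r_deriv H hz _
  have hrt : ∀ z ∈ bnV U1 U2 s, fderiv ℝ (bnr U1 U2 U3 s) z (0, 1) =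
      - bnl U1 U2 s z * bnE U1 U2 U3 s z := by
    intro z hz
    have hroot := (bn_mem hz).2.1
    rw [bn_r_deriv H hz, H.s1, H.s2, H.s3]
    unfold bnE
    linear_combination (fderiv ℝ U1 z (1, 0)) * hroot
  have hEs : ∀ z ∈ bnV U1 U2 s, ContDiffAt ℝ 1 (bnE U1 U2 U3 s) z := by
    intro z hz
    have d0 := (bn_l_smooth H.c1 H.c2 hz).of_le one_le_two
    have d1 := bn_dir_contDiffAt U1 z H.c1.contDiffAt (1, 0)
    have d2 := bn_dir_contDiffAt U2 z H.c2.contDiffAt (1, 0)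
    have d3 := bn_dir_contDiffAt U3 z H.c3.contDiffAt (1, 0)
    unfold bnE; fun_prop
  have hDs : ∀ z ∈ bnV U1 U2 s, ContDiffAt ℝ 1 (bnD U1 U2 s) z := by
    intro z hz
    have d0 := (bn_l_smooth H.c1 H.c2 hz).of_le one_le_two
    have d1 := H.c1.contDiffAt (x := z) |>.of_le one_le_two
    unfold bnD; fun_prop
  have hEt : ∀ z ∈ bnV U1 U2 s, fderiv ℝ (bnE U1 U2 U3 s) z (0, 1) =
      - bnl U1 U2 s z * fderiv ℝ (bnE U1 U2 U3 s) z (1, 0)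
      - fderiv ℝ (bnl U1 U2 s) z (1, 0) * bnE U1 U2 U3 s z := by
    intro z hz
    have d0 : DifferentiableAt ℝ (bnl U1 U2 s) z :=
      (bn_l_smooth H.c1 H.c2 hz).differentiableAt two_ne_zero
    have d1 : DifferentiableAt ℝ (bnE U1 U2 U3 s) z := (hEs z hz).differentiableAt one_ne_zero
    have hsy := bn_symm _ z (bn_r_smooth H hz) (1, 0) (0, 1)
    have e1 : (fun x => fderiv ℝ (bnr U1 U2 U3 s) x (1, 0)) =ᶠ[𝓝 z] bnE U1 U2 U3 s := by
      filter_upwards [hVo.mem_nhds hz] with x hx using hrq x hx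
    have e2 : (fun x => fderiv ℝ (bnr U1 U2 U3 s) x (0, 1)) =ᶠ[𝓝 z]
        fun x => - bnl U1 U2 s x * bnE U1 U2 U3 s x := by
      filter_upwards [hVo.mem_nhds hz] with x hx using hrt x hx
    rw [e1.fderiv_eq, e2.fderiv_eq] at hsy
    rw [hsy, fderiv_fun_mul d0.fun_neg d1, fderiv_fun_neg]
    simp
    ring
  set y : ℝ × ℝ → ℝ := fun z => bnD U1 U2 s z * bnE U1 U2 U3 s z ^ 2 with hy
  have hyd : ∀ z ∈ bnV U1 U2 s, ∀ v, fderiv ℝ y z v =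
      (6 * bnl U1 U2 s z * fderiv ℝ (bnl U1 U2 s) z v + 2 * fderiv ℝ U1 z v) * bnE U1 U2 U3 s z ^ 2
      + bnD U1 U2 s z * (2 * bnE U1 U2 U3 s z * fderiv ℝ (bnE U1 U2 U3 s) z v) := by
    intro z hz v
    have d0 : DifferentiableAt ℝ (bnl U1 U2 s) z :=
      (bn_l_smooth H.c1 H.c2 hz).differentiableAt two_ne_zero
    have d1 : DifferentiableAt ℝ (bnE U1 U2 U3 s) z := (hEs z hz).differentiableAt one_ne_zero
    have d2 : DifferentiableAt ℝ U1 z := H.c1.differentiable two_ne_zero z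
    rw [hy]
    unfold bnD
    simp (disch := fun_prop) [fderiv_fun_add, fderiv_fun_mul, fderiv_fun_pow]
    ring
  have har : ∀ z ∈ bnV U1 U2 s, ∀ v, fderiv ℝ (fun z => s * bnr U1 U2 U3 s z) z v =
      s * fderiv ℝ (bnr U1 U2 U3 s) z v := by
    intro z hz v
    rw [fderiv_const_mul ((bn_r_smooth H hz).differentiableAt two_ne_zero)]; simp
  have hσ : ∀ z ∈ bnV U1 U2 s, bnD U1 U2 s z * (fderiv ℝ y z (0, 1) *
      fderiv ℝ (fun z => s * bnr U1 U2 U3 s z) z (1, 0)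
      - fderiv ℝ y z (1, 0) * fderiv ℝ (fun z => s * bnr U1 U2 U3 s z) z (0, 1)) =
      6 * (s * bnl U1 U2 s z) * bnE U1 U2 U3 s z ^ 4 := by
    intro z hz
    have l1 := bn_l_deriv H.c1 H.c2 hz (1, 0)
    have l2 := bn_l_deriv H.c1 H.c2 hz (0, 1)
    have hroot := (bn_mem hz).2.1
    have hu2 : U2 z = - bnl U1 U2 s z ^ 3 - 2 * U1 z * bnl U1 U2 s z := by linarith
    rw [har z hz, har z hz, hrq z hz, hrt z hz, hyd z hz, hyd z hz, hEt z hz, H.s1]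
    rw [H.s1, H.s2] at l2
    have hE : bnE U1 U2 U3 s z = fderiv ℝ U1 z (1, 0) * bnl U1 U2 s z ^ 2
      + fderiv ℝ U2 z (1, 0) * bnl U1 U2 s z + fderiv ℝ U3 z (1, 0) := rfl
    have hD : bnD U1 U2 s z = 3 * bnl U1 U2 s z ^ 2 + 2 * U1 z := rfl
    rw [← hD] at l1 l2
    have l3 : bnD U1 U2 s z * (fderiv ℝ (bnl U1 U2 s) z (0, 1) +
        bnl U1 U2 s z * fderiv ℝ (bnl U1 U2 s) z (1, 0)) =
        bnE U1 U2 U3 s z - bnD U1 U2 s z * fderiv ℝ U1 z (1, 0) := by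
      rw [hE]
      linear_combination l2 + bnl U1 U2 s z * l1 + fderiv ℝ U1 z (1, 0) * hD
    linear_combination 6 * s * bnE U1 U2 U3 s z ^ 3 * bnl U1 U2 s z * l3
      - 2 * s * bnE U1 U2 U3 s z ^ 3 * bnD U1 U2 s z * l1
  have h0 := bn_locdiv (bnV U1 U2 s) hVo y (fun z => s * bnr U1 U2 U3 s z)
    ?_ ?_ (bn_V_per H s).1 (bn_V_per H s).2 ?_ ?_ ?_ ?_ ?_ ?_
  · have hE0 : bnE U1 U2 U3 s z₀ = 0 := by
      by_contra hE
      have hR := bn_mem hz₀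
      have hD : 0 < bnD U1 U2 s z₀ := hR.2.2
      have h1 := h0 z₀ hz₀ (by simp only [hy]; positivity)
      have h2 := hσ z₀ hz₀
      rw [h1] at h2
      have h3 := hR.1
      have : 0 < 6 * (s * bnl U1 U2 s z₀) * bnE U1 U2 U3 s z₀ ^ 4 := by positivity
      linarith
    apply bn_fderiv_zero
    · rw [hrq z₀ hz₀, hE0]
    · rw [hrt z₀ hz₀, hE0, mul_zero]
  · intro z hz
    exact (hDs z hz).mul ((hEs z hz).pow 2)
  · intro z hz
    exact contDiffAt_const.mul (bn_r_smooth H hz)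
  · intro z
    simp only [hy, bnD, bnE, (bn_l_per H s).1, H.q1, bn_per _ _ H.q1, bn_per _ _ H.q2,
      bn_per _ _ H.q3]
  · intro z
    simp only [hy, bnD, bnE, (bn_l_per H s).2, H.t1, bn_per _ _ H.t1, bn_per _ _ H.t2,
      bn_per _ _ H.t3]
  · intro z; simp only [bnr, (bn_l_per H s).1, H.q1, H.q2, H.q3]
  · intro z; simp only [bnr, (bn_l_per H s).2, H.t1, H.t2, H.t3]
  · intro ε hε
    have k1 := H.c1.continuous
    have k2 := H.c2.continuous
    have f1 : Continuous (fun z => fderiv ℝ U1 z (1, 0)) :=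
      (H.c1.continuous_fderiv two_ne_zero).clm_apply continuous_const
    have f2 : Continuous (fun z => fderiv ℝ U2 z (1, 0)) :=
      (H.c2.continuous_fderiv two_ne_zero).clm_apply continuous_const
    have f3 : Continuous (fun z => fderiv ℝ U3 z (1, 0)) :=
      (H.c3.continuous_fderiv two_ne_zero).clm_apply continuous_const
    have := bn_proj {p : (ℝ × ℝ) × ℝ | 0 ≤ s * p.2 ∧ p.2 ^ 3 + 2 * U1 p.1 * p.2 + U2 p.1 = 0 ∧
      2 * U1 p.1 + 3 / 4 * p.2 ^ 2 ≤ 0 ∧ 0 ≤ 3 * p.2 ^ 2 + 2 * U1 p.1 ∧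
      ε ≤ (3 * p.2 ^ 2 + 2 * U1 p.1) * (fderiv ℝ U1 p.1 (1, 0) * p.2 ^ 2
        + fderiv ℝ U2 p.1 (1, 0) * p.2 + fderiv ℝ U3 p.1 (1, 0)) ^ 2} ?_
      (fun z => 1 + 2 * |U1 z| + |U2 z|) (by fun_prop) ?_
    · convert this using 1
      ext z
      constructor
      · rintro ⟨hz, hyz⟩
        have hR := bn_mem hz
        exact ⟨bnl U1 U2 s z, hR.1.le, hR.2.1, hneg z hz, hR.2.2.le, hyz⟩
      · rintro ⟨l, h1, h2, h3, h4, h5⟩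
        simp only at h1 h2 h3 h4 h5
        have hD : 0 < 3 * l ^ 2 + 2 * U1 z := by
          rcases h4.lt_or_eq with h | h
          · exact h
          · rw [← h] at h5; linarith
        have hl : l ≠ 0 := by
          rintro rfl; linarith
        have hR : BnRoot s (U1 z) (U2 z) l :=
          ⟨lt_of_le_of_ne h1 (mul_ne_zero hs hl).symm, h2, hD⟩
        have he : bnl U1 U2 s z = l := bn_eq _ _ _ _ hR
        refine ⟨⟨l, hR⟩, ?_⟩
        simp only [hy, bnD, bnE, he]
        exact h5
    · refine IsClosed.and ?_ (IsClosed.and ?_ (IsClosed.and ?_ (IsClosed.and ?_ ?_)))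
      · exact isClosed_le (by fun_prop) (by fun_prop)
      · exact isClosed_eq (by fun_prop) (by fun_prop)
      · exact isClosed_le (by fun_prop) (by fun_prop)
      · exact isClosed_le (by fun_prop) (by fun_prop)
      · have g1 := f1.comp (continuous_fst (X := ℝ × ℝ) (Y := ℝ))
        have g2 := f2.comp (continuous_fst (X := ℝ × ℝ) (Y := ℝ))
        have g3 := f3.comp (continuous_fst (X := ℝ × ℝ) (Y := ℝ))
        simp only [Function.comp_def] at g1 g2 g3
        exact isClosed_le (by fun_prop) (by fun_prop)
    · rintro z l ⟨-, h, -⟩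
      exact bn_root_bound _ _ _ h
  · intro z hz
    have hR := bn_mem hz
    have hD : 0 < bnD U1 U2 s z := hR.2.2
    have h3 := hR.1
    have : 0 ≤ 6 * (s * bnl U1 U2 s z) * bnE U1 U2 U3 s z ^ 4 := by positivity
    rw [← hσ z hz] at this
    exact nonneg_of_mul_nonneg_right this hD

lemma bn_dq (u : ℝ → ℝ → ℝ) (hu : ContDiff ℝ 2 (fun z : ℝ × ℝ => u z.1 z.2)) (z : ℝ × ℝ) :
    deriv (fun x => u x z.2) z.1 = fderiv ℝ (fun z : ℝ × ℝ => u z.1 z.2) z (1, 0) := by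
  have h1 : HasFDerivAt (fun z : ℝ × ℝ => u z.1 z.2) _ (z.1, z.2) :=
    (hu.differentiable two_ne_zero z).hasFDerivAt
  have h2 : HasDerivAt (fun t : ℝ => (t, z.2)) ((1 : ℝ), (0 : ℝ)) z.1 :=
    (hasDerivAt_id z.1).prodMk (hasDerivAt_const z.1 z.2)
  exact (h1.comp_hasDerivAt z.1 h2).deriv

lemma bn_dt (u : ℝ → ℝ → ℝ) (hu : ContDiff ℝ 2 (fun z : ℝ × ℝ => u z.1 z.2)) (z : ℝ × ℝ) :
    deriv (fun x => u z.1 x) z.2 = fderiv ℝ (fun z : ℝ × ℝ => u z.1 z.2) z (0, 1) := by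
  have h1 : HasFDerivAt (fun z : ℝ × ℝ => u z.1 z.2) _ (z.1, z.2) :=
    (hu.differentiable two_ne_zero z).hasFDerivAt
  have h2 : HasDerivAt (fun t : ℝ => (z.1, t)) ((0 : ℝ), (1 : ℝ)) z.2 :=
    (hasDerivAt_const z.2 z.1).prodMk (hasDerivAt_id z.2)
  exact (h1.comp_hasDerivAt z.2 h2).deriv

lemma bn_vieta (x y a b c : ℝ) (hab : a < b) (hbc : b < c)
    (ha : a ^ 3 + 2 * x * a + y = 0) (hb : b ^ 3 + 2 * x * b + y = 0)
    (hc : c ^ 3 + 2 * x * c + y = 0) :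
    a + b + c = 0 ∧ 2 * x = a * b + b * c + c * a ∧ y = - (a * b * c) := by
  have h1 : a ^ 2 + a * b + b ^ 2 + 2 * x = 0 := by
    have : (a - b) * (a ^ 2 + a * b + b ^ 2 + 2 * x) = 0 := by linear_combination ha - hb
    exact (mul_eq_zero.mp this).resolve_left (by linarith)
  have h2 : b ^ 2 + b * c + c ^ 2 + 2 * x = 0 := by
    have : (b - c) * (b ^ 2 + b * c + c ^ 2 + 2 * x) = 0 := by linear_combination hb - hc
    exact (mul_eq_zero.mp this).resolve_left (by linarith)
  have h3 : a + b + c = 0 := by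
    have : (a - c) * (a + b + c) = 0 := by linear_combination h1 - h2
    exact (mul_eq_zero.mp this).resolve_left (by linarith)
  have hc' : c = -a - b := by linarith
  subst hc'
  have h4 : 2 * x = a * b + b * (-a - b) + (-a - b) * a := by linear_combination h1
  refine ⟨by ring, h4, ?_⟩
  linear_combination ha - a * h4

lemma bn_not_ell (x y a b c l : ℝ) (hab : a < b) (hbc : b < c)
    (ha : a ^ 3 + 2 * x * a + y = 0) (hb : b ^ 3 + 2 * x * b + y = 0)
    (hc : c ^ 3 + 2 * x * c + y = 0) (hl : l ^ 3 + 2 * x * l + y = 0) :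
    2 * x + 3 / 4 * l ^ 2 ≤ 0 := by
  obtain ⟨h1, h2, h3⟩ := bn_vieta x y a b c hab hbc ha hb hc
  have hc' : c = -a - b := by linarith
  have : (l - a) * ((l - b) * (l - c)) = 0 := by
    subst hc'
    linear_combination hl - l * h2 - h3
  rw [h2]
  subst hc'
  rcases mul_eq_zero.mp this with h | h
  · have : l = a := by linarith
    subst this; nlinarith [sq_nonneg (l + 2 * b)]
  · rcases mul_eq_zero.mp h with h | h
    · have : l = b := by linarith
      subst this; nlinarith [sq_nonneg (2 * a + l)]
    · have : l = -a - b := by linarith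
      subst this; nlinarith [sq_nonneg (a - b)]

lemma bn_const {U1 U2 U3 : ℝ × ℝ → ℝ} (H : BnSol U1 U2 U3) {s : ℝ} (hs : s ≠ 0)
    (Ω : Set (ℝ × ℝ)) (hΩ : IsOpen Ω) (lam r : ℝ × ℝ → ℝ)
    (hroot : ∀ z ∈ Ω, BnRoot s (U1 z) (U2 z) (lam z))
    (hel : ∀ z ∈ Ω, ∀ l, l ^ 3 + 2 * U1 z * l + U2 z = 0 → 2 * U1 z + 3 / 4 * l ^ 2 ≤ 0)
    (hr : ∀ z ∈ Ω, r z = lam z ^ 4 / 4 + U1 z * lam z ^ 2 + U2 z * lam z + U3 z) :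
    ∀ z ∈ Ω, ∀ w ∈ connectedComponentIn Ω z, r w = r z := by
  intro z hz w hw
  have hVe : ∀ x, x ∉ bnVe U1 U2 s := by
    apply bn_elliptic H hs z
    rintro ⟨h1, h2⟩
    have := hel z hz _ (bn_mem h1).2.1
    unfold bnm at h2
    linarith
  have hsub := connectedComponentIn_subset Ω z
  have hmem : ∀ x ∈ Ω, x ∈ bnV U1 U2 s := fun x hx => ⟨_, hroot x hx⟩
  have hreq : ∀ x ∈ Ω, r x = bnr U1 U2 U3 s x := by
    intro x hx
    rw [hr x hx]
    have : bnl U1 U2 s x = lam x := bn_eq _ _ _ _ (hroot x hx)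
    unfold bnr; rw [this]
  rw [hreq w (hsub hw), hreq z hz]
  refine (hΩ.connectedComponentIn).is_const_of_fderiv_eq_zero (𝕜 := ℝ) isPreconnected_connectedComponentIn
    ?_ ?_ hw (mem_connectedComponentIn hz)
  · intro x hx
    exact ((bn_r_smooth H (hmem x (hsub hx))).differentiableAt two_ne_zero).differentiableWithinAt
  · intro x hx
    exact bn_hyper H hs hVe x (hmem x (hsub hx))

end Bn


/-- for a smooth periodic solution of the n = 3 Benney reduction,
the Riemann invariants `r₁` and `r₃` are constant on every connected component
of the strictly hyperbolic region `Ω_h`. -/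
theorem riemann_invariants_constant_on_hyperbolic_components
    (u₁ u₂ u₃ : ℝ → ℝ → ℝ)
    (hu₁ : ContDiff ℝ (⊤ : ℕ∞) (fun z : ℝ × ℝ => u₁ z.1 z.2))
    (hu₂ : ContDiff ℝ (⊤ : ℕ∞) (fun z : ℝ × ℝ => u₂ z.1 z.2))
    (hu₃ : ContDiff ℝ (⊤ : ℕ∞) (fun z : ℝ × ℝ => u₃ z.1 z.2))
    (hq₁ : ∀ t, Function.Periodic (fun q => u₁ q t) 1)
    (hq₂ : ∀ t, Function.Periodic (fun q => u₂ q t) 1)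
    (hq₃ : ∀ t, Function.Periodic (fun q => u₃ q t) 1)
    (ht₁ : ∀ q, Function.Periodic (fun t => u₁ q t) 1)
    (ht₂ : ∀ q, Function.Periodic (fun t => u₂ q t) 1)
    (ht₃ : ∀ q, Function.Periodic (fun t => u₃ q t) 1)
    (hsys₁ : ∀ q t, deriv (fun s => u₁ q s) t + deriv (fun x => u₂ x t) q = 0)
    (hsys₂ : ∀ q t, deriv (fun s => u₂ q s) t + deriv (fun x => u₃ x t) q
        - 2 * u₁ q t * deriv (fun x => u₁ x t) q = 0)
    (hsys₃ : ∀ q t, deriv (fun s => u₃ q s) t - u₂ q t * deriv (fun x => u₁ x t) q = 0)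
    (Ωh : Set (ℝ × ℝ)) (hΩh_open : IsOpen Ωh)
    (hΩh : ∀ z : ℝ × ℝ, z ∈ Ωh ↔ ∃ a b c : ℝ, a < b ∧ b < c ∧
      a ^ 3 + 2 * u₁ z.1 z.2 * a + u₂ z.1 z.2 = 0 ∧
      b ^ 3 + 2 * u₁ z.1 z.2 * b + u₂ z.1 z.2 = 0 ∧
      c ^ 3 + 2 * u₁ z.1 z.2 * c + u₂ z.1 z.2 = 0)
    (lam : Fin 3 → ℝ × ℝ → ℝ)
    (hlam : ∀ i, ContDiffOn ℝ (⊤ : ℕ∞) (lam i) Ωh)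
    (horder : ∀ z ∈ Ωh, lam 0 z < lam 1 z ∧ lam 1 z < lam 2 z)
    (hroot : ∀ z ∈ Ωh, ∀ i : Fin 3,
      (lam i z) ^ 3 + 2 * u₁ z.1 z.2 * lam i z + u₂ z.1 z.2 = 0)
    (r : Fin 3 → ℝ × ℝ → ℝ)
    (hr : ∀ i z, r i z = (lam i z) ^ 4 / 4 + u₁ z.1 z.2 * (lam i z) ^ 2
      + u₂ z.1 z.2 * lam i z + u₃ z.1 z.2) :
    ∀ z ∈ Ωh, ∀ w ∈ connectedComponentIn Ωh z, r 0 w = r 0 z ∧ r 2 w = r 2 z := by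
  have c1 : ContDiff ℝ 2 (fun z : ℝ × ℝ => u₁ z.1 z.2) := contDiff_infty.mp hu₁ 2
  have c2 : ContDiff ℝ 2 (fun z : ℝ × ℝ => u₂ z.1 z.2) := contDiff_infty.mp hu₂ 2
  have c3 : ContDiff ℝ 2 (fun z : ℝ × ℝ => u₃ z.1 z.2) := contDiff_infty.mp hu₃ 2
  have H : BnSol (fun z : ℝ × ℝ => u₁ z.1 z.2) (fun z : ℝ × ℝ => u₂ z.1 z.2)
      (fun z : ℝ × ℝ => u₃ z.1 z.2) := by
    refine ⟨c1, c2, c3, ?_, ?_, ?_, ?_, ?_, ?_, ?_, ?_, ?_⟩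
    · intro z; simpa using hq₁ z.2 z.1
    · intro z; simpa using hq₂ z.2 z.1
    · intro z; simpa using hq₃ z.2 z.1
    · intro z; simpa using ht₁ z.1 z.2
    · intro z; simpa using ht₂ z.1 z.2
    · intro z; simpa using ht₃ z.1 z.2
    · intro z
      have := hsys₁ z.1 z.2
      rw [bn_dt u₁ c1, bn_dq u₂ c2] at this
      linarith
    · intro z
      have := hsys₂ z.1 z.2
      rw [bn_dt u₂ c2, bn_dq u₃ c3, bn_dq u₁ c1] at this
      linarith
    · intro z
      have := hsys₃ z.1 z.2
      rw [bn_dt u₃ c3, bn_dq u₁ c1] at this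
      linarith
  have hel : ∀ z ∈ Ωh, ∀ l, l ^ 3 + 2 * u₁ z.1 z.2 * l + u₂ z.1 z.2 = 0 →
      2 * u₁ z.1 z.2 + 3 / 4 * l ^ 2 ≤ 0 := by
    intro z hz l hl
    obtain ⟨a, b, c, hab, hbc, ha, hb, hc⟩ := (hΩh z).mp hz
    exact bn_not_ell _ _ a b c l hab hbc ha hb hc hl
  intro z hz w hw
  constructor
  · refine bn_const H (s := -1) (by norm_num) Ωh hΩh_open (lam 0) (r 0) ?_ hel
      (fun z _ => hr 0 z) z hz w hw
    intro x hx
    obtain ⟨h01, h12⟩ := horder x hx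
    obtain ⟨v1, v2, -⟩ := bn_vieta _ _ _ _ _ h01 h12 (hroot x hx 0) (hroot x hx 1) (hroot x hx 2)
    refine ⟨by linarith, hroot x hx 0, ?_⟩
    have e : lam 2 x = - lam 0 x - lam 1 x := by linarith
    have := mul_pos (sub_pos.mpr h01) (sub_pos.mpr (h01.trans h12))
    rw [e] at v2 this
    rw [v2]
    nlinarith
  · refine bn_const H (s := 1) (by norm_num) Ωh hΩh_open (lam 2) (r 2) ?_ hel
      (fun z _ => hr 2 z) z hz w hw
    intro x hx
    obtain ⟨h01, h12⟩ := horder x hx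
    obtain ⟨v1, v2, -⟩ := bn_vieta _ _ _ _ _ h01 h12 (hroot x hx 0) (hroot x hx 1) (hroot x hx 2)
    refine ⟨by linarith, hroot x hx 2, ?_⟩
    have e : lam 0 x = - lam 2 x - lam 1 x := by linarith
    have := mul_pos (sub_pos.mpr h12) (sub_pos.mpr (h01.trans h12))
    rw [e] at v2 this
    rw [v2]
    nlinarith
end
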